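/- If Z : Conv_sc(ℝⁿ) → ℝ is a continuous and epi-translation invariant valuation, then there exist continuous and epi-translation invariant valuations Z₀, Z₁, …, Z_n : Conv_sc(ℝⁿ) → ℝ such that Z_i is epi-homogeneous of degree i for each i ∈ {0,…,n} and Z = Z₀ + Z₁ + ⋯ + Z_n. -/

import Mathlib

open Filter Topology MeasureTheory

noncomputable section

/-- Euclidean space `ℝⁿ`. -/
abbrev Vn (n : ℕ) := EuclideanSpace ℝ (Fin n)

/-- `u : ℝⁿ → ℝ ∪ {+∞}` (represented as an `EReal`-valued function that never
takes the value `⊥ = -∞`) is convex. -/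
def IsConvexFn {n : ℕ} (u : Vn n → EReal) : Prop :=
  ∀ x y : Vn n, ∀ t : ℝ, 0 < t → t < 1 →
    u (t • x + (1 - t) • y) ≤ (t : EReal) * u x + ((1 - t : ℝ) : EReal) * u y

/-- `Conv(ℝⁿ)`: convex, lower semicontinuous, proper functions
`ℝⁿ → ℝ ∪ {+∞}`. -/
def ConvSet (n : ℕ) : Set (Vn n → EReal) :=
  {u | IsConvexFn u ∧ LowerSemicontinuous u ∧ (∀ x, u x ≠ ⊥) ∧ (∃ x, u x ≠ ⊤)}

/-- `Conv_sc(ℝⁿ)`: super-coercive elements of `Conv(ℝⁿ)`, i.e.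
`u(x)/|x| → +∞` as `|x| → +∞`. -/
def ConvSc (n : ℕ) : Set (Vn n → EReal) :=
  {u | u ∈ ConvSet n ∧
    ∀ M : ℝ, ∃ R : ℝ, ∀ x : Vn n, R ≤ ‖x‖ → ((M * ‖x‖ : ℝ) : EReal) ≤ u x}

/-- Epi-convergence of a sequence `uk` to `u`. -/
def EpiConverges {n : ℕ} (uk : ℕ → Vn n → EReal) (u : Vn n → EReal) : Prop :=
  ∀ x : Vn n,
    (∀ xk : ℕ → Vn n, Tendsto xk atTop (𝓝 x) →
      u x ≤ liminf (fun k => uk k (xk k)) atTop) ∧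
    (∃ xk : ℕ → Vn n, Tendsto xk atTop (𝓝 x) ∧
      Tendsto (fun k => uk k (xk k)) atTop (𝓝 (u x)))

/-- Continuity (with respect to epi-convergence) of a functional on a class `X`. -/
def ContinuousVal {n : ℕ} (X : Set (Vn n → EReal)) (Z : (Vn n → EReal) → ℝ) : Prop :=
  ∀ (uk : ℕ → Vn n → EReal) (u : Vn n → EReal),
    (∀ k, uk k ∈ X) → u ∈ X → EpiConverges uk u →
      Tendsto (fun k => Z (uk k)) atTop (𝓝 (Z u))

/-- The valuation property on a class `X` (here `⊔`, `⊓` are the pointwise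
maximum and minimum). -/
def IsValuation {n : ℕ} (X : Set (Vn n → EReal)) (Z : (Vn n → EReal) → ℝ) : Prop :=
  ∀ u v : Vn n → EReal, u ∈ X → v ∈ X → u ⊔ v ∈ X → u ⊓ v ∈ X →
    Z (u ⊔ v) + Z (u ⊓ v) = Z u + Z v

/-- Epi-translation invariance: invariance under `u ↦ u(· - x₀) + c`. -/
def EpiTranslationInvariant {n : ℕ} (X : Set (Vn n → EReal)) (Z : (Vn n → EReal) → ℝ) : Prop :=
  ∀ u ∈ X, ∀ x₀ : Vn n, ∀ c : ℝ, Z (fun x => u (x - x₀) + (c : EReal)) = Z u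

-- Epi-multiplication `λ ⊡ u`; for `λ = 0` it is the indicator of `{0}`.
open Classical in
def epiMul {n : ℕ} (l : ℝ) (u : Vn n → EReal) : Vn n → EReal :=
  if l = 0 then (fun x => if x = 0 then (0 : EReal) else ⊤)
  else fun x => (l : EReal) * u (l⁻¹ • x)

/-- `Z` is epi-homogeneous of degree `α`: `Z(λ ⊡ u) = λ^α Z(u)` for `λ > 0`. -/
def EpiHomogeneous {n : ℕ} (X : Set (Vn n → EReal)) (Z : (Vn n → EReal) → ℝ) (α : ℝ) : Prop :=
  ∀ u ∈ X, ∀ l : ℝ, 0 < l → Z (epiMul l u) = l ^ α * Z u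


/-- Faulhaber: sums of a polynomial over an initial segment are polynomial. -/
lemma exists_poly_sum (p : Polynomial ℝ) :
    ∃ q : Polynomial ℝ, ∀ k : ℕ, ∑ j ∈ Finset.range k, p.eval (j : ℝ) = q.eval (k : ℝ) := by
  induction p using Polynomial.induction_on' with
  | add p q hp hq =>
    obtain ⟨a, ha⟩ := hp
    obtain ⟨b, hb⟩ := hq
    exact ⟨a + b, fun k => by simp [Finset.sum_add_distrib, ha, hb]⟩
  | monomial d c =>
    refine ⟨∑ i ∈ Finset.range (d + 1), Polynomial.monomial (d + 1 - i)
      (c * ((bernoulli i : ℚ) : ℝ) * ((d + 1).choose i : ℝ) / ((d : ℝ) + 1)), fun k => ?_⟩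
    have h := congrArg (fun x : ℚ => (x : ℝ)) (sum_range_pow k d)
    simp only [Rat.cast_sum, Rat.cast_pow, Rat.cast_natCast, Rat.cast_div, Rat.cast_mul,
      Rat.cast_add, Rat.cast_one] at h
    simp only [Polynomial.eval_monomial, Polynomial.eval_finsetSum]
    rw [← Finset.mul_sum, h, Finset.mul_sum]
    refine Finset.sum_congr rfl fun i _ => ?_
    ring

lemma poly_of_diff (g : ℝ → ℝ)
    (hc : ∀ (x : ℕ → ℝ) (s : ℝ), (∀ i, 0 ≤ x i) → 0 ≤ s → Tendsto x atTop (𝓝 s) →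
      Tendsto (fun i => g (x i)) atTop (𝓝 (g s)))
    (hd : ∀ t : ℝ, 0 ≤ t → ∃ p : Polynomial ℝ, ∀ s, 0 ≤ s → g (s + t) - g s = p.eval s) :
    ∃ q : Polynomial ℝ, ∀ s, 0 ≤ s → g s = q.eval s := by
  have key : ∀ N : ℕ, 0 < N → ∃ q : Polynomial ℝ, ∀ k : ℕ, g ((k : ℝ) / N) = q.eval (k : ℝ) := by
    intro N hN
    have hN' : (0 : ℝ) < N := by exact_mod_cast hN
    obtain ⟨p, hp⟩ := hd (1 / N) (by positivity)
    obtain ⟨q, hq⟩ := exists_poly_sum (p.comp (Polynomial.C (1 / (N : ℝ)) * Polynomial.X))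
    refine ⟨Polynomial.C (g 0) + q, fun k => ?_⟩
    rw [Polynomial.eval_add, ← hq, Polynomial.eval_C]
    induction k with
    | zero => simp
    | succ k ih =>
      rw [Finset.sum_range_succ, ← add_assoc, ← ih]
      have := hp ((k : ℝ) / N) (by positivity)
      simp only [Polynomial.eval_comp, Polynomial.eval_mul, Polynomial.eval_C, Polynomial.eval_X]
      rw [show 1 / (N : ℝ) * k = k / N by ring, ← this]
      push_cast
      rw [add_div]; ring
  obtain ⟨q, hq⟩ := key 1 one_pos
  simp only [Nat.cast_one, div_one] at hq
  have hrat : ∀ N : ℕ, 0 < N → ∀ k : ℕ, g ((k : ℝ) / N) = q.eval ((k : ℝ) / N) := by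
    intro N hN k
    have hN' : (N : ℝ) ≠ 0 := by exact_mod_cast hN.ne'
    obtain ⟨r, hr⟩ := key N hN
    have : r.comp (Polynomial.C (N : ℝ) * Polynomial.X) = q := by
      refine Polynomial.eq_of_infinite_eval_eq _ _ ?_
      refine (Set.infinite_range_of_injective (Nat.cast_injective (R := ℝ))).mono ?_
      rintro _ ⟨j, rfl⟩
      have h1 := hr (N * j)
      have h2 := hq j
      simp only [Set.mem_ofPred_eq, Polynomial.eval_comp, Polynomial.eval_mul, Polynomial.eval_C,
        Polynomial.eval_X]
      rw [← h2]
      push_cast at h1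
      rw [← h1]
      congr 1
      field_simp
    rw [hr, ← this]
    simp only [Polynomial.eval_comp, Polynomial.eval_mul, Polynomial.eval_C, Polynomial.eval_X]
    congr 1
    field_simp
  refine ⟨q, fun s hs => ?_⟩
  have hlim : Tendsto (fun N : ℕ => (⌊s * ((N : ℝ) + 1)⌋₊ : ℝ) / ((N + 1 : ℕ) : ℝ)) atTop (𝓝 s) := by
    have h1 := (tendsto_nat_floor_mul_div_atTop (R := ℝ) hs).comp
      (tendsto_natCast_atTop_atTop (R := ℝ))
    have h2 := h1.comp (tendsto_add_atTop_nat 1)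
    refine h2.congr fun N => ?_
    simp
  have h1 := hc _ s (fun i => by positivity) hs hlim
  have h2 : Tendsto (fun N : ℕ => q.eval ((⌊s * ((N : ℝ) + 1)⌋₊ : ℝ) / ((N + 1 : ℕ) : ℝ)))
      atTop (𝓝 (q.eval s)) := (q.continuous.tendsto s).comp hlim
  refine tendsto_nhds_unique h1 (h2.congr fun N => ?_)
  exact (hrat (N + 1) (Nat.succ_pos _) _).symm

lemma natDegree_le_of_growth (p : Polynomial ℝ) (n : ℕ) (C : ℝ)
    (h : ∀ k : ℕ, 1 ≤ k → |p.eval (k : ℝ)| ≤ C * (k : ℝ) ^ n) : p.natDegree ≤ n := by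
  by_contra hcon
  push Not at hcon
  have hdeg : (Polynomial.X ^ n : Polynomial ℝ).degree < p.degree := by
    rw [Polynomial.degree_X_pow]
    exact (Polynomial.natDegree_lt_natDegree_iff (p := (Polynomial.X ^ n : Polynomial ℝ)) (by simp)).1
      (by simpa using hcon) |> fun h => by simpa using h
  have h1 := (Polynomial.abs_div_tendsto_atTop_atTop_of_degree_gt p _ hdeg (by simp)).comp
    (tendsto_natCast_atTop_atTop (R := ℝ))
  obtain ⟨k, hk1, hk2⟩ := ((h1.eventually_gt_atTop C).and (eventually_ge_atTop 1)).exists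
  have hk : (0 : ℝ) < (k : ℝ) ^ n := by
    have : (0 : ℝ) < k := by exact_mod_cast hk2
    positivity
  simp only [Function.comp, Polynomial.eval_pow, Polynomial.eval_X, abs_div, abs_of_pos hk] at hk1
  rw [lt_div_iff₀ hk] at hk1
  exact absurd (h k hk2) (not_le.2 hk1)

/-- A convex body: a nonempty compact convex set. -/
structure IsBody {E : Type*} [NormedAddCommGroup E] [NormedSpace ℝ E] (K : Set E) : Prop where
  compact : IsCompact K
  convex : Convex ℝ K
  nonempty : K.Nonempty

/-- A continuous translation invariant valuation on convex bodies. -/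
structure BodyVal {E : Type*} [NormedAddCommGroup E] [NormedSpace ℝ E] (φ : Set E → ℝ) : Prop where
  val : ∀ K L, IsBody K → IsBody L → Convex ℝ (K ∪ L) → (K ∩ L).Nonempty →
    φ (K ∪ L) + φ (K ∩ L) = φ K + φ L
  ti : ∀ K, IsBody K → ∀ x, φ ((fun y => x + y) '' K) = φ K
  cont : ∀ (Ks : ℕ → Set E) (K : Set E), (∀ i, IsBody (Ks i)) → IsBody K →
    Tendsto (fun i => Metric.hausdorffDist (Ks i) K) atTop (𝓝 0) →
    Tendsto (fun i => φ (Ks i)) atTop (𝓝 (φ K))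

section Bodies

variable {E : Type*} [NormedAddCommGroup E] [NormedSpace ℝ E]

lemma IsBody.inter {K L : Set E} (hK : IsBody K) (hL : IsBody L) (h : (K ∩ L).Nonempty) :
    IsBody (K ∩ L) :=
  ⟨hK.compact.inter hL.compact, hK.convex.inter hL.convex, h⟩

lemma IsBody.trans {K : Set E} (hK : IsBody K) (x : E) : IsBody ((fun y => x + y) '' K) :=
  ⟨hK.compact.image (by fun_prop), hK.convex.translate x, hK.nonempty.image _⟩

/-- The sets `{y + a z : (y,a) ∈ J, z ∈ D}`. -/
def ExtS (J : Set (E × ℝ)) (D : Set E) : Set E :=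
  {x | ∃ y a z, (y, a) ∈ J ∧ z ∈ D ∧ x = y + a • z}

lemma ext_combine {D : Set E} (hD : Convex ℝ D) {a b θ η : ℝ} {z w : E} (ha : 0 ≤ a) (hb : 0 ≤ b)
    (hθ : 0 ≤ θ) (hη : 0 ≤ η) (hz : z ∈ D) (hw : w ∈ D) :
    ∃ c ∈ D, θ • (a • z) + η • (b • w) = (θ * a + η * b) • c := by
  by_cases h0 : θ * a + η * b = 0
  · have h1 : 0 ≤ θ * a := by positivity
    have h2 : 0 ≤ η * b := by positivity
    have h3 : θ * a = 0 := by linarith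
    have h4 : η * b = 0 := by linarith
    refine ⟨z, hz, ?_⟩
    rw [smul_smul, smul_smul, h3, h4]; simp
  · have h1 : 0 ≤ θ * a := by positivity
    have h2 : 0 ≤ η * b := by positivity
    have hp : 0 < θ * a + η * b := lt_of_le_of_ne (by linarith) (Ne.symm h0)
    refine ⟨(θ * a / (θ * a + η * b)) • z + (η * b / (θ * a + η * b)) • w,
      hD hz hw (by positivity) (by positivity) (by field_simp), ?_⟩
    rw [smul_add, smul_smul, smul_smul, smul_smul, smul_smul, mul_div_cancel₀ _ h0,
      mul_div_cancel₀ _ h0]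

lemma ExtS_convex {J : Set (E × ℝ)} {D : Set E} (hJ : Convex ℝ J) (hJ0 : ∀ q ∈ J, 0 ≤ q.2)
    (hD : Convex ℝ D) : Convex ℝ (ExtS J D) := by
  rintro _ ⟨y, a, z, hya, hz, rfl⟩ _ ⟨y', a', z', hya', hz', rfl⟩ θ η hθ hη hs
  obtain ⟨c, hc, hcc⟩ := ext_combine hD (hJ0 _ hya) (hJ0 _ hya') hθ hη hz hz'
  refine ⟨θ • y + η • y', θ * a + η * a', c, ?_, hc, ?_⟩
  · simpa using hJ hya hya' hθ hη hs
  · rw [← hcc, smul_add, smul_add]; abel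

lemma ExtS_eq_image (J : Set (E × ℝ)) (D : Set E) :
    ExtS J D = (fun p : (E × ℝ) × E => p.1.1 + p.1.2 • p.2) '' (J ×ˢ D) := by
  ext x
  constructor
  · rintro ⟨y, a, z, h1, h2, rfl⟩
    exact ⟨((y, a), z), ⟨h1, h2⟩, rfl⟩
  · rintro ⟨⟨⟨y, a⟩, z⟩, ⟨h1, h2⟩, rfl⟩
    exact ⟨y, a, z, h1, h2, rfl⟩

lemma ExtS_body {J : Set (E × ℝ)} {D : Set E} (hJ : IsBody J) (hJ0 : ∀ q ∈ J, 0 ≤ q.2)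
    (hD : IsBody D) : IsBody (ExtS J D) := by
  refine ⟨?_, ExtS_convex hJ.convex hJ0 hD.convex, ?_⟩
  · rw [ExtS_eq_image]
    exact (hJ.compact.prod hD.compact).image (by fun_prop)
  · rw [ExtS_eq_image]
    exact (hJ.nonempty.prod hD.nonempty).image _

lemma ExtS_union (J J' : Set (E × ℝ)) (D : Set E) : ExtS (J ∪ J') D = ExtS J D ∪ ExtS J' D := by
  rw [ExtS_eq_image, ExtS_eq_image, ExtS_eq_image, Set.union_prod, Set.image_union]

lemma ExtS_cut {φ : Set E → ℝ} (hφ : BodyVal φ) {J : Set (E × ℝ)} {D : Set E} (hJ : IsBody J)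
    (hJ0 : ∀ q ∈ J, 0 ≤ q.2) (hD : IsBody D) (s : ℝ) (h1 : ∃ q ∈ J, q.2 ≤ s)
    (h2 : ∃ q ∈ J, s ≤ q.2) :
    φ (ExtS J D) + φ (ExtS {q ∈ J | q.2 = s} D) =
      φ (ExtS {q ∈ J | q.2 ≤ s} D) + φ (ExtS {q ∈ J | s ≤ q.2} D) := by
  have hb1 : IsBody {q ∈ J | q.2 ≤ s} := by
    refine ⟨hJ.compact.inter_right (isClosed_le continuous_snd continuous_const), ?_, h1⟩
    rintro p ⟨hp, hp'⟩ q ⟨hq, hq'⟩ a b ha hb hab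
    refine ⟨hJ.convex hp hq ha hb hab, ?_⟩
    have e : s = a * s + b * s := by rw [← add_mul, hab, one_mul]
    have i1 := mul_le_mul_of_nonneg_left hp' ha
    have i2 := mul_le_mul_of_nonneg_left hq' hb
    simp only [Prod.snd_add, Prod.smul_snd, smul_eq_mul]
    linarith
  have hb2 : IsBody {q ∈ J | s ≤ q.2} := by
    refine ⟨hJ.compact.inter_right (isClosed_le continuous_const continuous_snd), ?_, h2⟩
    rintro p ⟨hp, hp'⟩ q ⟨hq, hq'⟩ a b ha hb hab
    refine ⟨hJ.convex hp hq ha hb hab, ?_⟩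
    have e : s = a * s + b * s := by rw [← add_mul, hab, one_mul]
    have i1 := mul_le_mul_of_nonneg_left hp' ha
    have i2 := mul_le_mul_of_nonneg_left hq' hb
    simp only [Prod.snd_add, Prod.smul_snd, smul_eq_mul]
    linarith
  have e1 := ExtS_body hb1 (fun q hq => hJ0 q hq.1) hD
  have e2 := ExtS_body hb2 (fun q hq => hJ0 q hq.1) hD
  have hu : ExtS {q ∈ J | q.2 ≤ s} D ∪ ExtS {q ∈ J | s ≤ q.2} D = ExtS J D := by
    rw [← ExtS_union]
    congr 1
    ext q
    simp only [Set.mem_union, Set.mem_ofPred_eq]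
    have := le_total q.2 s
    tauto
  have comb : ∀ q ∈ J, ∀ q' ∈ J, q.2 ≤ s → s ≤ q'.2 → ∃ θ η : ℝ, 0 ≤ θ ∧ 0 ≤ η ∧ θ + η = 1 ∧
      θ * q.2 + η * q'.2 = s := by
    intro q _ q' _ h h'
    by_cases he : q.2 = q'.2
    · exact ⟨1, 0, by norm_num, by norm_num, by norm_num, by linarith⟩
    · have : 0 < q'.2 - q.2 := sub_pos.2 (lt_of_le_of_ne (h.trans h') he)
      refine ⟨(q'.2 - s) / (q'.2 - q.2), (s - q.2) / (q'.2 - q.2),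
        div_nonneg (by linarith) this.le, div_nonneg (by linarith) this.le, ?_, ?_⟩
      · field_simp; ring
      · field_simp; ring
  have hi : ExtS {q ∈ J | q.2 ≤ s} D ∩ ExtS {q ∈ J | s ≤ q.2} D = ExtS {q ∈ J | q.2 = s} D := by
    ext x
    constructor
    · rintro ⟨⟨y, a, z, ⟨hya, has⟩, hz, rfl⟩, ⟨y', a', z', ⟨hya', has'⟩, hz', hx⟩⟩
      obtain ⟨θ, η, hθ, hη, hsum, hcomb⟩ := comb _ hya _ hya' has has'
      obtain ⟨c, hc, hcc⟩ := ext_combine hD.convex (hJ0 _ hya) (hJ0 _ hya') hθ hη hz hz'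
      simp only at hcomb hcc
      refine ⟨θ • y + η • y', s, c, ⟨?_, rfl⟩, hc, ?_⟩
      · have := hJ.convex hya hya' hθ hη hsum
        simpa [hcomb] using this
      · rw [hcomb] at hcc
        rw [← hcc]
        have e : y + a • z = θ • (y + a • z) + η • (y' + a' • z') := by
          rw [← hx, ← add_smul, hsum, one_smul]
        rw [e, smul_add, smul_add]; abel
    · rintro ⟨y, a, z, ⟨hya, has⟩, hz, rfl⟩
      simp only at has
      exact ⟨⟨y, a, z, ⟨hya, has.le⟩, hz, rfl⟩, ⟨y, a, z, ⟨hya, has.ge⟩, hz, rfl⟩⟩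
  have hne : (ExtS {q ∈ J | q.2 ≤ s} D ∩ ExtS {q ∈ J | s ≤ q.2} D).Nonempty := by
    rw [hi]
    obtain ⟨q, hq, hqs⟩ := h1
    obtain ⟨q', hq', hqs'⟩ := h2
    obtain ⟨θ, η, hθ, hη, hsum, hcomb⟩ := comb _ hq _ hq' hqs hqs'
    obtain ⟨z, hz⟩ := hD.nonempty
    refine ⟨_, (θ • q + η • q').1, (θ • q + η • q').2, z,
      ⟨hJ.convex hq hq' hθ hη hsum, ?_⟩, hz, rfl⟩
    simpa using hcomb
  have := hφ.val _ _ e1 e2 (by rw [hu]; exact ExtS_convex hJ.convex hJ0 hD.convex) hne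
  rwa [hu, hi] at this

/-- The cone with apex `0` over `v + D`. -/
def cone0 (v : E) (D : Set E) : Set E := {x | ∃ (b : ℝ) (z : E), 0 ≤ b ∧ b ≤ 1 ∧ z ∈ D ∧ x = b • (v + z)}

def shiftJ (s : ℝ) (J : Set (E × ℝ)) : Set (E × ℝ) := (fun q => ((0 : E), s) + q) '' J

def Susp (v : E) (J : Set (E × ℝ)) (c : ℝ) : Set (E × ℝ) :=
  {q | ∃ y a, (y, a) ∈ J ∧ c ≤ q.2 ∧ q.2 ≤ a ∧ q.1 = y + q.2 • v}

lemma mem_shiftJ {s : ℝ} {J : Set (E × ℝ)} {y : E} {a : ℝ} :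
    (y, a) ∈ shiftJ s J ↔ (y, a - s) ∈ J := by
  constructor
  · rintro ⟨⟨y', a'⟩, h, he⟩
    simp only [Prod.mk_add_mk, zero_add, Prod.mk.injEq] at he
    obtain ⟨rfl, rfl⟩ := he
    simpa using h
  · intro h
    exact ⟨_, h, by simp⟩

lemma shiftJ_body {J : Set (E × ℝ)} (hJ : IsBody J) (s : ℝ) : IsBody (shiftJ s J) := hJ.trans _

lemma prod_body {K : Set E} (hK : IsBody K) (t : ℝ) : IsBody (K ×ˢ ({t} : Set ℝ)) :=
  ⟨hK.compact.prod isCompact_singleton, hK.convex.prod (convex_singleton t),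
    hK.nonempty.prod (Set.singleton_nonempty t)⟩

lemma fst_body {J : Set (E × ℝ)} (hJ : IsBody J) : IsBody (Prod.fst '' J) :=
  ⟨hJ.compact.image continuous_fst, hJ.convex.linear_image (LinearMap.fst ℝ E ℝ),
    hJ.nonempty.image _⟩

lemma Susp_body {J : Set (E × ℝ)} (hJ : IsBody J) (v : E) (c : ℝ) (hc : ∀ q ∈ J, c ≤ q.2) :
    IsBody (Susp v J c) := by
  refine ⟨?_, ?_, ?_⟩
  · have : Susp v J c = (fun p : (E × ℝ) × ℝ =>
        (p.1.1 + (c + p.2 * (p.1.2 - c)) • v, c + p.2 * (p.1.2 - c))) '' (J ×ˢ Set.Icc 0 1) := by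
      ext ⟨x, b⟩
      constructor
      · rintro ⟨y, a, hya, h1, h2, h3⟩
        simp only at h1 h2 h3
        by_cases hac : a = c
        · refine ⟨((y, a), 0), ⟨hya, by simp⟩, ?_⟩
          have : b = c := by linarith
          simp [h3, this]
        · have hpos : 0 < a - c := sub_pos.2 (lt_of_le_of_ne (hc _ hya) (Ne.symm hac))
          have e : c + (b - c) / (a - c) * (a - c) = b := by field_simp; ring
          refine ⟨((y, a), (b - c) / (a - c)), ⟨hya, div_nonneg (by linarith) hpos.le,
            (div_le_one hpos).2 (by linarith)⟩, ?_⟩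
          simp only [e, h3]
      · rintro ⟨⟨⟨y, a⟩, t⟩, ⟨hya, ht0, ht1⟩, he⟩
        simp only [Prod.mk.injEq] at he ht0 ht1
        have := hc _ hya
        simp only at this
        refine ⟨y, a, hya, ?_, ?_, ?_⟩
        · simp only [← he.2]; nlinarith
        · simp only [← he.2]; nlinarith
        · simp only [← he.2, ← he.1]
    rw [this]
    exact (hJ.compact.prod isCompact_Icc).image (by fun_prop)
  · rintro ⟨x, b⟩ ⟨y, a, hya, h1, h2, h3⟩ ⟨x', b'⟩ ⟨y', a', hya', h1', h2', h3'⟩ θ η hθ hη hs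
    simp only at h1 h2 h3 h1' h2' h3'
    refine ⟨θ • y + η • y', θ * a + η * a', by simpa using hJ.convex hya hya' hθ hη hs, ?_, ?_, ?_⟩
    · have e : c = θ * c + η * c := by rw [← add_mul, hs, one_mul]
      have i1 := mul_le_mul_of_nonneg_left h1 hθ
      have i2 := mul_le_mul_of_nonneg_left h1' hη
      simp only [Prod.snd_add, Prod.smul_snd, smul_eq_mul]; linarith
    · have i1 := mul_le_mul_of_nonneg_left h2 hθ
      have i2 := mul_le_mul_of_nonneg_left h2' hη
      simp only [Prod.snd_add, Prod.smul_snd, smul_eq_mul]; linarith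
    · simp only [Prod.snd_add, Prod.smul_snd, smul_eq_mul, Prod.fst_add, Prod.smul_fst, h3, h3']
      rw [smul_add, smul_add, add_smul, smul_smul, smul_smul]; abel
  · obtain ⟨⟨y, a⟩, h⟩ := hJ.nonempty
    exact ⟨(y + a • v, a), y, a, h, by simpa using hc _ h, le_rfl, rfl⟩

lemma ExtS_cone (J : Set (E × ℝ)) (hJ0 : ∀ q ∈ J, 0 ≤ q.2) (v : E) (D : Set E) :
    ExtS J (cone0 v D) = ExtS (Susp v J 0) D := by
  ext x
  constructor
  · rintro ⟨y, a, _, hya, ⟨b, z, hb0, hb1, hz, rfl⟩, rfl⟩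
    have := hJ0 _ hya
    simp only at this
    refine ⟨y + (a * b) • v, a * b, z, ⟨y, a, hya, by simp only; positivity,
      by simp only; nlinarith, rfl⟩, hz, ?_⟩
    rw [smul_smul, smul_add]; abel
  · rintro ⟨y', b, z, ⟨y, a, hya, h1, h2, h3⟩, hz, rfl⟩
    simp only at h1 h2 h3
    by_cases ha : a = 0
    · have : b = 0 := by linarith
      refine ⟨y, a, _, hya, ⟨0, z, le_rfl, zero_le_one, hz, rfl⟩, ?_⟩
      simp [h3, this]
    · have hpos : 0 < a := lt_of_le_of_ne (hJ0 _ hya) (Ne.symm ha)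
      refine ⟨y, a, _, hya, ⟨b / a, z, by positivity, (div_le_one hpos).2 h2, hz, rfl⟩, ?_⟩
      rw [smul_smul, mul_div_cancel₀ _ ha, smul_add, h3]; abel

lemma cone0_body {D : Set E} (hD : IsBody D) (v : E) : IsBody (cone0 v D) := by
  have : cone0 v D = ExtS (({(0 : E)} : Set E) ×ˢ ({1} : Set ℝ)) (cone0 v D) := by
    ext x
    constructor
    · intro h
      exact ⟨0, 1, x, by simp, h, by simp⟩
    · rintro ⟨y, a, z, h, hz, rfl⟩
      simp only [Set.mem_prod, Set.mem_singleton_iff] at h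
      rw [h.1, h.2]; simpa using hz
  have hs : IsBody ({(0 : E)} : Set E) := ⟨isCompact_singleton, convex_singleton _, by simp⟩
  have h0 : ∀ q ∈ (({(0 : E)} : Set E) ×ˢ ({1} : Set ℝ)), (0 : ℝ) ≤ q.2 := by
    rintro ⟨y, a⟩ h
    simp only [Set.mem_prod, Set.mem_singleton_iff] at h
    simp [h.2]
  rw [this, ExtS_cone _ h0]
  refine ExtS_body (Susp_body (prod_body hs 1) v 0 h0) ?_ hD
  rintro q ⟨y, a, h, h1, h2, h3⟩
  exact h1

lemma ExtS_trans (w : E) (c : ℝ) (J : Set (E × ℝ)) (D : Set E) :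
    ExtS ((fun q => (w, (0 : ℝ)) + q) '' J) D = (fun y => w + y) '' ExtS J D := by
  ext x
  constructor
  · rintro ⟨_, _, z, ⟨⟨y, a⟩, hya, he⟩, hz, rfl⟩
    simp only [Prod.mk_add_mk, zero_add, Prod.mk.injEq] at he
    refine ⟨y + a • z, ⟨y, a, z, hya, hz, rfl⟩, ?_⟩
    rw [← he.1, ← he.2]; simp only; abel
  · rintro ⟨_, ⟨y, a, z, hya, hz, rfl⟩, rfl⟩
    refine ⟨w + y, a, z, ⟨(y, a), hya, by simp⟩, hz, by simp only; abel⟩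

/-- The basic recursion for cones. -/
lemma cone_step {φ : Set E → ℝ} (hφ : BodyVal φ) {J : Set (E × ℝ)} {D : Set E} (hJ : IsBody J)
    (hJ0 : ∀ q ∈ J, 0 ≤ q.2) (hD : IsBody D) (v : E) (s : ℝ) (hs : 0 ≤ s) :
    φ (ExtS (shiftJ s J) (cone0 v D)) = φ (ExtS ((Prod.fst '' J) ×ˢ {s}) (cone0 v D))
      - φ (ExtS (shiftJ s ((Prod.fst '' J) ×ˢ {0})) D) + φ (ExtS (shiftJ s (Susp v J 0)) D) := by
  have hsJ := shiftJ_body hJ s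
  have hsJ0 : ∀ q ∈ shiftJ s J, s ≤ q.2 := by
    rintro ⟨y, a⟩ h
    have := hJ0 _ (mem_shiftJ.1 h)
    simp only at this ⊢
    linarith
  have hsJ0' : ∀ q ∈ shiftJ s J, 0 ≤ q.2 := fun q hq => hs.trans (hsJ0 q hq)
  have hpr0 : ∀ q ∈ (Prod.fst '' J) ×ˢ ({s} : Set ℝ), 0 ≤ q.2 := by
    rintro ⟨y, a⟩ h
    simp only [Set.mem_prod, Set.mem_singleton_iff] at h
    simp only [h.2, hs]
  have hS : IsBody (Susp v (shiftJ s J) 0) := Susp_body hsJ v 0 hsJ0'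
  have hS0 : ∀ q ∈ Susp v (shiftJ s J) 0, 0 ≤ q.2 := by
    rintro q ⟨y, a, h, h1, h2, h3⟩
    exact h1
  obtain ⟨⟨y0, a0⟩, h00⟩ := hsJ.nonempty
  have ha0 := hsJ0 _ h00
  simp only at ha0
  have cut := ExtS_cut hφ hS hS0 hD s
    ⟨(y0, 0), ⟨y0, a0, h00, le_rfl, hs.trans ha0, by simp⟩, hs⟩
    ⟨(y0 + a0 • v, a0), ⟨y0, a0, h00, hs.trans ha0, le_rfl, rfl⟩, ha0⟩
  have e1 : {q ∈ Susp v (shiftJ s J) 0 | q.2 ≤ s} = Susp v ((Prod.fst '' J) ×ˢ {s}) 0 := by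
    ext ⟨x, b⟩
    constructor
    · rintro ⟨⟨y, a, h, h1, h2, h3⟩, hb⟩
      exact ⟨y, s, ⟨⟨_, mem_shiftJ.1 h, rfl⟩, rfl⟩, h1, hb, h3⟩
    · rintro ⟨y, a, ⟨⟨⟨y', a'⟩, h, h'⟩, ha⟩, h1, h2, h3⟩
      simp only at h' h1 h2 h3
      simp only [Set.mem_singleton_iff] at ha
      subst h' ha
      have := hJ0 _ h
      simp only at this
      exact ⟨⟨y', a' + a, mem_shiftJ.2 (by simpa using h), h1, by simp only; linarith, h3⟩, h2⟩
  have e2 : {q ∈ Susp v (shiftJ s J) 0 | q.2 = s} =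
      (fun q => (s • v, (0 : ℝ)) + q) '' (shiftJ s ((Prod.fst '' J) ×ˢ {0})) := by
    ext ⟨x, b⟩
    constructor
    · rintro ⟨⟨y, a, h, h1, h2, h3⟩, hb⟩
      simp only at hb h3
      refine ⟨(y, s), mem_shiftJ.2 ⟨⟨_, mem_shiftJ.1 h, rfl⟩, by simp⟩, ?_⟩
      simp [h3, hb, add_comm]
    · rintro ⟨⟨y, a⟩, h, he⟩
      obtain ⟨⟨⟨y', a'⟩, h', h''⟩, ha⟩ := mem_shiftJ.1 h
      simp only [Prod.mk_add_mk, zero_add, Prod.mk.injEq] at he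
      simp only [Set.mem_singleton_iff] at ha
      simp only at h''
      subst h''
      obtain ⟨rfl, rfl⟩ := he
      have has : a = s := by linarith
      subst has
      have := hJ0 _ h'
      simp only at this
      refine ⟨⟨y', a' + a, mem_shiftJ.2 (by simpa using h'), hs, by simp only; linarith, ?_⟩, rfl⟩
      simp only; abel
  have e3 : {q ∈ Susp v (shiftJ s J) 0 | s ≤ q.2} =
      (fun q => (s • v, (0 : ℝ)) + q) '' (shiftJ s (Susp v J 0)) := by
    ext ⟨x, b⟩
    constructor
    · rintro ⟨⟨y, a, h, h1, h2, h3⟩, hb⟩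
      simp only at hb h3 h2
      refine ⟨(y + (b - s) • v, b), mem_shiftJ.2 ⟨y, a - s, mem_shiftJ.1 h, by simp only; linarith,
        by simp only; linarith, rfl⟩, ?_⟩
      simp only [Prod.mk_add_mk, zero_add, h3, sub_smul, Prod.mk.injEq, and_true]
      abel
    · rintro ⟨⟨y, a⟩, h, he⟩
      obtain ⟨y', a', h', h1, h2, h3⟩ := mem_shiftJ.1 h
      simp only [Prod.mk_add_mk, zero_add, Prod.mk.injEq] at he
      simp only at h1 h2 h3
      obtain ⟨rfl, rfl⟩ := he
      refine ⟨⟨y', a' + s, mem_shiftJ.2 (by simpa using h'), by simp only; linarith,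
        by simp only; linarith, ?_⟩, by simp only; linarith⟩
      simp only [h3, sub_smul]; abel
  have hSJ : IsBody (Susp v J 0) := Susp_body hJ v 0 hJ0
  have hSJ0 : ∀ q ∈ shiftJ s (Susp v J 0), 0 ≤ q.2 := by
    rintro ⟨x, b⟩ h
    obtain ⟨y', a', h', h1, h2, h3⟩ := mem_shiftJ.1 h
    simp only at h1 ⊢
    linarith
  have hp0 : ∀ q ∈ shiftJ s ((Prod.fst '' J) ×ˢ {0}), 0 ≤ q.2 := by
    rintro ⟨x, b⟩ h
    obtain ⟨_, h'⟩ := mem_shiftJ.1 h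
    simp only [Set.mem_singleton_iff] at h'
    simp only
    linarith
  rw [e1, e2, e3, ExtS_trans _ 0, ExtS_trans _ 0,
    hφ.ti _ (ExtS_body (shiftJ_body (prod_body (fst_body hJ) 0) s) hp0 hD),
    hφ.ti _ (ExtS_body (shiftJ_body hSJ s) hSJ0 hD), ← ExtS_cone _ hsJ0', ← ExtS_cone _ hpr0] at cut
  linarith

/-- `s ↦ φ(ExtS(J + (0,s), D))` is a polynomial. -/
def GoodD (φ : Set E → ℝ) (D : Set E) : Prop :=
  IsBody D ∧ ∀ J : Set (E × ℝ), IsBody J → (∀ q ∈ J, 0 ≤ q.2) →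
    ∃ p : Polynomial ℝ, ∀ s, 0 ≤ s → φ (ExtS (shiftJ s J) D) = p.eval s

lemma goodD_zero (φ : Set E → ℝ) : GoodD φ ({0} : Set E) := by
  refine ⟨⟨isCompact_singleton, convex_singleton _, by simp⟩, fun J _ _ => ?_⟩
  refine ⟨Polynomial.C (φ (Prod.fst '' J)), fun s _ => ?_⟩
  rw [Polynomial.eval_C]
  congr 1
  ext x
  constructor
  · rintro ⟨y, a, z, h, hz, rfl⟩
    refine ⟨_, mem_shiftJ.1 h, ?_⟩
    simp only [Set.mem_singleton_iff] at hz
    simp [hz]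
  · rintro ⟨⟨y, a⟩, h, rfl⟩
    exact ⟨y, a + s, 0, mem_shiftJ.2 (by simpa using h), rfl, by simp⟩

lemma shiftJ_prod (K : Set E) (s t : ℝ) : shiftJ s (K ×ˢ ({t} : Set ℝ)) = K ×ˢ {s + t} := by
  ext ⟨x, b⟩
  rw [mem_shiftJ]
  simp only [Set.mem_prod, Set.mem_singleton_iff]
  constructor <;> rintro ⟨h1, h2⟩ <;> exact ⟨h1, by linarith⟩

lemma cont_scale {φ : Set E → ℝ} (hφ : BodyVal φ) {K C : Set E} (hK : IsBody K) (hC : IsBody C)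
    (x : ℕ → ℝ) (s : ℝ) (hx0 : ∀ i, 0 ≤ x i) (hs : 0 ≤ s) (hx : Tendsto x atTop (𝓝 s)) :
    Tendsto (fun i => φ (ExtS (K ×ˢ {x i}) C)) atTop (𝓝 (φ (ExtS (K ×ˢ {s}) C))) := by
  have hb : ∀ t : ℝ, 0 ≤ t → IsBody (ExtS (K ×ˢ {t}) C) := by
    intro t ht
    refine ExtS_body (prod_body hK t) ?_ hC
    rintro ⟨y, a⟩ h
    simp only [Set.mem_prod, Set.mem_singleton_iff] at h
    simp only [h.2, ht]
  refine hφ.cont _ _ (fun i => hb _ (hx0 i)) (hb s hs) ?_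
  obtain ⟨R, hR⟩ := hC.compact.isBounded.exists_norm_le
  have hR' : ∀ z ∈ C, ‖z‖ ≤ |R| := fun z hz => (hR z hz).trans (le_abs_self R)
  have hlim : Tendsto (fun i => |x i - s| * |R|) atTop (𝓝 0) := by
    have h1 : Tendsto (fun i => |x i - s|) atTop (𝓝 0) := by
      have := (hx.sub_const s).abs
      simpa using this
    simpa using h1.mul_const |R|
  have key : ∀ a b : ℝ, ∀ w ∈ ExtS (K ×ˢ {a}) C, ∃ w' ∈ ExtS (K ×ˢ {b}) C,
      dist w w' ≤ |a - b| * |R| := by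
    rintro a b _ ⟨y, a', z, h, hz, rfl⟩
    simp only [Set.mem_prod, Set.mem_singleton_iff] at h
    refine ⟨y + b • z, ⟨y, b, z, ⟨h.1, rfl⟩, hz, rfl⟩, ?_⟩
    rw [h.2, dist_add_left, dist_eq_norm, ← sub_smul, norm_smul, Real.norm_eq_abs]
    exact mul_le_mul_of_nonneg_left (hR' z hz) (abs_nonneg _)
  refine squeeze_zero (fun i => Metric.hausdorffDist_nonneg) (fun i => ?_) hlim
  refine Metric.hausdorffDist_le_of_mem_dist (by positivity) (key _ _) ?_
  intro w hw
  obtain ⟨w', h1, h2⟩ := key s (x i) w hw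
  exact ⟨w', h1, by rwa [abs_sub_comm] at h2⟩

lemma goodD_cone {φ : Set E → ℝ} (hφ : BodyVal φ) {D : Set E} (hD : GoodD φ D) (v : E) :
    GoodD φ (cone0 v D) := by
  obtain ⟨hDb, hDp⟩ := hD
  have hcb := cone0_body hDb v
  have hnn : ∀ (K : Set E) (t : ℝ), 0 ≤ t → ∀ q ∈ K ×ˢ ({t} : Set ℝ), 0 ≤ q.2 := by
    rintro K t ht ⟨y, a⟩ h
    simp only [Set.mem_prod, Set.mem_singleton_iff] at h
    simp only [h.2, ht]
  have hSn : ∀ (J : Set (E × ℝ)), ∀ q ∈ Susp v J 0, 0 ≤ q.2 := by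
    rintro J q ⟨y, a, h, h1, h2, h3⟩
    exact h1
  have step1 : ∀ K : Set E, IsBody K → ∃ p : Polynomial ℝ, ∀ s, 0 ≤ s →
      φ (ExtS (K ×ˢ {s}) (cone0 v D)) = p.eval s := by
    intro K hK
    refine poly_of_diff (fun s => φ (ExtS (K ×ˢ {s}) (cone0 v D)))
      (fun x s h1 h2 h3 => cont_scale hφ hK hcb x s h1 h2 h3) (fun t ht => ?_)
    have hfst : Prod.fst '' (K ×ˢ ({t} : Set ℝ)) = K := Set.fst_image_prod K (Set.singleton_nonempty t)
    obtain ⟨p, hp⟩ := hDp (K ×ˢ {0}) (prod_body hK 0) (hnn K 0 le_rfl)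
    obtain ⟨q, hq⟩ := hDp (Susp v (K ×ˢ {t}) 0) (Susp_body (prod_body hK t) v 0 (hnn K t ht))
      (hSn _)
    refine ⟨q - p, fun s hs => ?_⟩
    have := cone_step hφ (prod_body hK t) (hnn K t ht) hDb v s hs
    rw [hfst, shiftJ_prod K s t, hp s hs, hq s hs] at this
    simp only [this, Polynomial.eval_sub]
    ring
  refine ⟨hcb, fun J hJ hJ0 => ?_⟩
  obtain ⟨g, hg⟩ := step1 _ (fst_body hJ)
  obtain ⟨p, hp⟩ := hDp ((Prod.fst '' J) ×ˢ {0}) (prod_body (fst_body hJ) 0) (hnn _ 0 le_rfl)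
  obtain ⟨q, hq⟩ := hDp (Susp v J 0) (Susp_body hJ v 0 hJ0) (hSn _)
  refine ⟨g - p + q, fun s hs => ?_⟩
  rw [cone_step hφ hJ hJ0 hDb v s hs, hg s hs, hp s hs, hq s hs]
  simp

lemma polytope_good {φ : Set E → ℝ} (hφ : BodyVal φ) (t : Finset E) (ht : t.Nonempty) :
    ∃ (x : E) (D : Set E), GoodD φ D ∧ convexHull ℝ (t : Set E) = (fun y => x + y) '' D := by
  classical
  induction ht using Finset.Nonempty.cons_induction with
  | singleton a => exact ⟨a, {0}, goodD_zero φ, by simp⟩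
  | cons a s ha hs ih =>
    obtain ⟨x, D, hD, he⟩ := ih
    refine ⟨a, cone0 (x - a) D, goodD_cone hφ hD _, ?_⟩
    rw [Finset.coe_cons, convexHull_insert (by exact_mod_cast hs), he]
    ext w
    rw [mem_convexJoin]
    constructor
    · rintro ⟨a', ha', _, ⟨z, hz, rfl⟩, hw⟩
      rw [Set.mem_singleton_iff] at ha'
      subst ha'
      rw [segment_eq_image'] at hw
      obtain ⟨b, ⟨hb0, hb1⟩, rfl⟩ := hw
      refine ⟨b • (x - a' + z), ⟨b, z, hb0, hb1, hz, rfl⟩, ?_⟩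
      simp only
      congr 2; abel
    · rintro ⟨_, ⟨b, z, hb0, hb1, hz, rfl⟩, rfl⟩
      refine ⟨a, rfl, x + z, ⟨z, hz, rfl⟩, ?_⟩
      rw [segment_eq_image']
      refine ⟨b, ⟨hb0, hb1⟩, ?_⟩
      simp only
      congr 2; abel

lemma polytope_poly {φ : Set E → ℝ} (hφ : BodyVal φ) (t : Finset E) (ht : t.Nonempty) :
    ∃ p : Polynomial ℝ, ∀ s : ℝ, 0 ≤ s →
      φ ((fun y => s • y) '' convexHull ℝ (t : Set E)) = p.eval s := by
  obtain ⟨x, D, hD, he⟩ := polytope_good hφ t ht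
  have hs0 : IsBody ({(0 : E)} : Set E) := ⟨isCompact_singleton, convex_singleton _, by simp⟩
  obtain ⟨p, hp⟩ := hD.2 (({(0 : E)} : Set E) ×ˢ {0}) (prod_body hs0 0) (by
    rintro ⟨y, a⟩ h
    simp only [Set.mem_prod, Set.mem_singleton_iff] at h
    simp [h.2])
  refine ⟨p, fun s hs => ?_⟩
  rw [← hp s hs, he, shiftJ_prod, add_zero]
  have hb : IsBody (ExtS (({(0 : E)} : Set E) ×ˢ {s}) D) := by
    refine ExtS_body (prod_body hs0 s) ?_ hD.1
    rintro ⟨y, a⟩ h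
    simp only [Set.mem_prod, Set.mem_singleton_iff] at h
    simp only [h.2, hs]
  rw [← hφ.ti _ hb (s • x)]
  congr 1
  ext w
  constructor
  · rintro ⟨_, ⟨z, hz, rfl⟩, rfl⟩
    exact ⟨s • z, ⟨0, s, z, ⟨rfl, rfl⟩, hz, by simp⟩, by simp⟩
  · rintro ⟨_, ⟨y, a, z, ⟨h1, h2⟩, hz, rfl⟩, rfl⟩
    simp only [Set.mem_singleton_iff] at h1 h2
    exact ⟨x + z, ⟨z, hz, rfl⟩, by simp [h1, h2]⟩

end Bodies

section Growth

variable {E : Type*} [NormedAddCommGroup E] [NormedSpace ℝ E]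

/-- Affine functions (in the weak form we need). -/
def IsAff (f : E → ℝ) : Prop :=
  Continuous f ∧ ∀ x y : E, ∀ a b : ℝ, a + b = 1 → f (a • x + b • y) = a * f x + b * f y

lemma IsBody.le_body {K : Set E} (hK : IsBody K) {f : E → ℝ} (hf : IsAff f) (s : ℝ)
    (h : ∃ x ∈ K, f x ≤ s) : IsBody {x ∈ K | f x ≤ s} := by
  refine ⟨hK.compact.inter_right (isClosed_le hf.1 continuous_const), ?_, h⟩
  rintro p ⟨hp, hp'⟩ q ⟨hq, hq'⟩ a b ha hb hab
  refine ⟨hK.convex hp hq ha hb hab, ?_⟩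
  have e : s = a * s + b * s := by rw [← add_mul, hab, one_mul]
  have i1 := mul_le_mul_of_nonneg_left hp' ha
  have i2 := mul_le_mul_of_nonneg_left hq' hb
  rw [hf.2 p q a b hab]
  linarith

lemma IsBody.ge_body {K : Set E} (hK : IsBody K) {f : E → ℝ} (hf : IsAff f) (s : ℝ)
    (h : ∃ x ∈ K, s ≤ f x) : IsBody {x ∈ K | s ≤ f x} := by
  refine ⟨hK.compact.inter_right (isClosed_le continuous_const hf.1), ?_, h⟩
  rintro p ⟨hp, hp'⟩ q ⟨hq, hq'⟩ a b ha hb hab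
  refine ⟨hK.convex hp hq ha hb hab, ?_⟩
  have e : s = a * s + b * s := by rw [← add_mul, hab, one_mul]
  have i1 := mul_le_mul_of_nonneg_left hp' ha
  have i2 := mul_le_mul_of_nonneg_left hq' hb
  rw [hf.2 p q a b hab]
  linarith

lemma IsBody.cut_union {K : Set E} (f : E → ℝ) (s : ℝ) :
    {x ∈ K | f x ≤ s} ∪ {x ∈ K | s ≤ f x} = K := by
  ext q
  simp only [Set.mem_union, Set.mem_ofPred_eq]
  have := le_total (f q) s
  tauto

lemma IsBody.cut_inter {K : Set E} (hK : IsBody K) {f : E → ℝ} (hf : IsAff f) (s : ℝ)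
    (h : ∃ x ∈ K, f x ≤ s) (h' : ∃ x ∈ K, s ≤ f x) :
    ({x ∈ K | f x ≤ s} ∩ {x ∈ K | s ≤ f x}).Nonempty := by
  obtain ⟨x, hx, h⟩ := h
  obtain ⟨y, hy, h'⟩ := h'
  by_cases he : f x = f y
  · exact ⟨x, ⟨hx, h⟩, ⟨hx, by linarith⟩⟩
  · have : 0 < f y - f x := sub_pos.2 (lt_of_le_of_ne (h.trans h') he)
    have hs : (f y - s) / (f y - f x) + (s - f x) / (f y - f x) = 1 := by field_simp; ring
    have hm := hK.convex hx hy (a := (f y - s) / (f y - f x)) (b := (s - f x) / (f y - f x))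
      (div_nonneg (by linarith) this.le) (div_nonneg (by linarith) this.le) hs
    have hv := hf.2 x y _ _ hs
    have : (f y - s) / (f y - f x) * f x + (s - f x) / (f y - f x) * f y = s := by
      field_simp; ring
    rw [this] at hv
    exact ⟨_, ⟨hm, hv.le⟩, ⟨hm, hv.ge⟩⟩

lemma convex_of_hausdorff_limit (Ks : ℕ → Set E) (K : Set E) (hKs : ∀ i, IsBody (Ks i))
    (hK : IsCompact K) (hne : K.Nonempty)
    (h : Tendsto (fun i => Metric.hausdorffDist (Ks i) K) atTop (𝓝 0)) : Convex ℝ K := by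
  intro x hx y hy a b ha hb hab
  rw [hK.isClosed.mem_iff_infDist_zero hne]
  refine le_antisymm (le_of_forall_pos_le_add fun ε hε => ?_) Metric.infDist_nonneg
  obtain ⟨i, hi⟩ := ((tendsto_order.1 h).2 (ε / 2) (by linarith)).exists
  have hfin : Metric.hausdorffEDist (Ks i) K ≠ ⊤ :=
    Metric.hausdorffEDist_ne_top_of_nonempty_of_bounded (hKs i).nonempty hne
      (hKs i).compact.isBounded hK.isBounded
  obtain ⟨x', hx', hxx⟩ := Metric.exists_dist_lt_of_hausdorffDist_lt' hx hi hfin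
  obtain ⟨y', hy', hyy⟩ := Metric.exists_dist_lt_of_hausdorffDist_lt' hy hi hfin
  have hm := (hKs i).convex hx' hy' ha hb hab
  obtain ⟨z, hz, hzz⟩ := Metric.exists_dist_lt_of_hausdorffDist_lt hm hi hfin
  have h1 := Metric.infDist_le_dist_of_mem (x := a • x + b • y) hz
  have h2 : dist (a • x + b • y) (a • x' + b • y') ≤ ε / 2 := by
    refine (dist_add_add_le _ _ _ _).trans ?_
    rw [dist_smul₀, dist_smul₀, Real.norm_of_nonneg ha, Real.norm_of_nonneg hb,
      dist_comm x, dist_comm y]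
    have i1 := mul_le_mul_of_nonneg_left hxx.le ha
    have i2 := mul_le_mul_of_nonneg_left hyy.le hb
    have e : ε / 2 = a * (ε / 2) + b * (ε / 2) := by rw [← add_mul, hab, one_mul]
    linarith
  have h3 := dist_triangle (a • x + b • y) (a • x' + b • y') z
  linarith

lemma bound_of_compact {φ : Set E → ℝ} (hφ : BodyVal φ) {Q : Set E} (hQ : IsCompact Q) :
    ∃ C : ℝ, 0 ≤ C ∧ ∀ K, IsBody K → K ⊆ Q → |φ K| ≤ C := by
  by_contra hcon
  push Not at hcon
  choose Ks hb hsub hbig using fun i : ℕ => hcon i (Nat.cast_nonneg i)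
  let L : ℕ → TopologicalSpace.NonemptyCompacts E :=
    fun i => ⟨⟨Ks i, (hb i).compact⟩, (hb i).nonempty⟩
  obtain ⟨K, -, σ, hσ, hlim⟩ :=
    (TopologicalSpace.NonemptyCompacts.isCompact_subsets_of_isCompact hQ).tendsto_subseq
      (x := L) (fun i => hsub i)
  have hd : Tendsto (fun i => Metric.hausdorffDist (Ks (σ i)) (K : Set E)) atTop (𝓝 0) :=
    tendsto_iff_dist_tendsto_zero.1 hlim
  have hKb : IsBody (K : Set E) := ⟨K.isCompact,
    convex_of_hausdorff_limit _ _ (fun i => hb (σ i)) K.isCompact K.nonempty hd, K.nonempty⟩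
  have ht := (hφ.cont _ _ (fun i => hb (σ i)) hKb hd).abs
  have hinf : Tendsto (fun i => |φ (Ks (σ i))|) atTop atTop := by
    refine tendsto_atTop_mono (fun i => (hbig (σ i)).le) ?_
    exact tendsto_natCast_atTop_atTop.comp hσ.tendsto_atTop
  exact not_tendsto_nhds_of_tendsto_atTop hinf _ ht

lemma coord_aff {n : ℕ} (i : Fin n) : IsAff (fun x : Vn n => x i) := by
  refine ⟨by fun_prop, fun x y a b _ => by simp⟩

lemma cube_compact (n : ℕ) : ∃ Q : Set (Vn n), IsCompact Q ∧
    ∀ x : Vn n, (∀ i, 0 ≤ x i ∧ x i ≤ 1) → x ∈ Q := by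
  refine ⟨_, (isCompact_univ_pi (s := fun _ : Fin n => Set.Icc (0 : ℝ) 1)
    fun _ => isCompact_Icc).image (PiLp.continuous_toLp 2 _), fun x hx => ?_⟩
  exact ⟨x.ofLp, fun i _ => hx i, rfl⟩

lemma box_bound {n : ℕ} {φ : Set (Vn n) → ℝ} (hφ : BodyVal φ) {C : ℝ} (hC0 : 0 ≤ C)
    (hC : ∀ K, IsBody K → (∀ x ∈ K, ∀ i, 0 ≤ x i ∧ x i ≤ 1) → |φ K| ≤ C) (k : ℕ) (hk : 1 ≤ k)
    (S : Finset (Fin n)) : ∀ K, IsBody K →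
      (∀ x ∈ K, ∀ i, 0 ≤ x i ∧ x i ≤ if i ∈ S then (k : ℝ) else 1) →
      |φ K| ≤ C * (2 * k) ^ S.card := by
  induction S using Finset.induction_on with
  | empty => intro K hK h; simpa using hC K hK (by simpa using h)
  | insert a S ha ih =>
    set B := C * (2 * (k : ℝ)) ^ S.card with hB
    have hB0 : 0 ≤ B := by positivity
    have claim : ∀ j : ℕ, 1 ≤ j → ∀ K, IsBody K →
        (∀ x ∈ K, (∀ i, i ≠ a → 0 ≤ x i ∧ x i ≤ if i ∈ S then (k : ℝ) else 1) ∧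
          0 ≤ x a ∧ x a ≤ (j : ℝ)) → |φ K| ≤ (2 * j - 1) * B := by
      intro j hj
      induction j, hj using Nat.le_induction with
      | base =>
        intro K hK h
        have := ih K hK (fun x hx i => by
          by_cases hi : i = a
          · subst hi
            simpa [ha] using (h x hx).2
          · exact (h x hx).1 i hi)
        push_cast
        linarith
      | succ j hj ihj =>
        intro K hK h
        have hj1 : (1 : ℝ) ≤ j := by exact_mod_cast hj
        have upper : ∀ L, IsBody L → L ⊆ K → (∀ x ∈ L, (j : ℝ) ≤ x a) → |φ L| ≤ B := by
          intro L hL hLK hLj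
          rw [← hφ.ti L hL (-EuclideanSpace.single a (j : ℝ))]
          refine ih _ (hL.trans _) ?_
          rintro _ ⟨x, hx, rfl⟩ i
          have hh := h x (hLK hx)
          have := hLj x hx
          by_cases hi : i = a
          · subst hi
            have h2 := hh.2
            push_cast at h2
            simp only [PiLp.add_apply, PiLp.neg_apply, PiLp.single_apply, if_true, ha,
              if_false]
            constructor <;> linarith
          · simpa [hi] using hh.1 i hi
        push_cast
        by_cases h1 : ∃ x ∈ K, x a ≤ (j : ℝ)
        · by_cases h2 : ∃ x ∈ K, (j : ℝ) ≤ x a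
          · have b1 := hK.le_body (coord_aff a) j h1
            have b2 := hK.ge_body (coord_aff a) j h2
            have hi := hK.cut_inter (coord_aff a) j h1 h2
            have hv := hφ.val _ _ b1 b2 (by rw [IsBody.cut_union]; exact hK.convex) hi
            rw [IsBody.cut_union] at hv
            have e1 := ihj _ b1 (fun x hx => ⟨(h x hx.1).1, (h x hx.1).2.1, hx.2⟩)
            have e2 := upper _ b2 (fun x hx => hx.1) (fun x hx => hx.2)
            have e3 := upper _ (b1.inter b2 hi) (fun x hx => hx.1.1) (fun x hx => hx.2.2)
            rw [abs_le] at e1 e2 e3 ⊢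
            constructor <;> linarith
          · push Not at h2
            have := ihj K hK (fun x hx => ⟨(h x hx).1, (h x hx).2.1, (h2 x hx).le⟩)
            linarith
        · push Not at h1
          have := upper K hK le_rfl (fun x hx => (h1 x hx).le)
          nlinarith
    intro K hK h
    have := claim k hk K hK (fun x hx => ⟨fun i hi => by simpa [hi] using h x hx i,
      by simpa using h x hx a⟩)
    rw [Finset.card_insert_of_notMem ha, pow_succ]
    have e : C * ((2 * (k : ℝ)) ^ S.card * (2 * k)) = 2 * k * B := by rw [hB]; ring
    rw [e]
    linarith

lemma hull_body (t : Finset E) (ht : t.Nonempty) : IsBody (convexHull ℝ (t : Set E)) :=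
  ⟨t.finite_toSet.isCompact_convexHull ℝ, convex_convexHull _ _,
    (by exact_mod_cast ht : (t : Set E).Nonempty).convexHull⟩

lemma IsBody.smul {K : Set E} (hK : IsBody K) (s : ℝ) : IsBody ((fun y => s • y) '' K) :=
  ⟨hK.compact.image (by fun_prop), hK.convex.smul s, hK.nonempty.image _⟩

lemma polytope_poly_deg {n : ℕ} {φ : Set (Vn n) → ℝ} (hφ : BodyVal φ) (t : Finset (Vn n))
    (ht : t.Nonempty) :
    ∃ p : Polynomial ℝ, p.natDegree ≤ n ∧ ∀ s : ℝ, 0 ≤ s →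
      φ ((fun y => s • y) '' convexHull ℝ (t : Set (Vn n))) = p.eval s := by
  obtain ⟨p, hp⟩ := polytope_poly hφ t ht
  have hP := hull_body t ht
  obtain ⟨Q, hQ, hQ'⟩ := cube_compact n
  obtain ⟨C, hC0, hC⟩ := bound_of_compact hφ hQ
  obtain ⟨R, hR⟩ := hP.compact.isBounded.exists_norm_le
  obtain ⟨N, hN⟩ := exists_nat_ge (max R 1)
  have hN1 : (1 : ℝ) ≤ N := (le_max_right _ _).trans hN
  refine ⟨p, natDegree_le_of_growth p n (C * (4 * N) ^ n) (fun k hk => ?_), hp⟩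
  rw [← hp k (Nat.cast_nonneg k)]
  have hb := hP.smul (k : ℝ)
  let w : Vn n := WithLp.toLp 2 (fun _ => (k * N : ℝ))
  rw [← hφ.ti _ hb w]
  have hk1 : (1 : ℝ) ≤ k := by exact_mod_cast hk
  have := box_bound hφ hC0 (fun K hK h => hC K hK (fun x hx => hQ' x (h x hx))) (2 * k * N)
    (by
      have h1 : 1 ≤ N := by exact_mod_cast hN1
      have := Nat.mul_le_mul hk h1
      nlinarith) Finset.univ
    _ (hb.trans w) (by
      rintro _ ⟨_, ⟨x, hx, rfl⟩, rfl⟩ i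
      have h1 : |x i| ≤ N := by
        have := (PiLp.norm_apply_le x i).trans (hR x hx)
        rw [Real.norm_eq_abs] at this
        exact this.trans ((le_max_left _ _).trans hN)
      rw [abs_le] at h1
      simp only [PiLp.add_apply, PiLp.smul_apply, smul_eq_mul, Finset.mem_univ, if_true, w]
      push_cast
      constructor <;> nlinarith)
  rw [Finset.card_univ, Fintype.card_fin] at this
  refine this.trans (le_of_eq ?_)
  push_cast
  rw [mul_assoc C, ← mul_pow]
  ring

end Growth

section Epi

variable {n : ℕ}

lemma epiMul_apply {l : ℝ} (hl : 0 < l) (u : Vn n → EReal) (x : Vn n) :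
    epiMul l u x = (l : EReal) * u (l⁻¹ • x) := by
  unfold epiMul
  rw [if_neg hl.ne']

lemma coe_mul_cont {l : ℝ} (hl : 0 < l) : Continuous (fun a : EReal => (l : EReal) * a) := by
  rw [continuous_iff_continuousAt]
  intro a
  have h0 : (l : EReal) ≠ 0 := by exact_mod_cast hl.ne'
  have h := EReal.continuousAt_mul (p := ((l : EReal), a)) (Or.inl h0) (Or.inl h0)
    (Or.inl (EReal.coe_ne_bot l)) (Or.inl (EReal.coe_ne_top l))
  exact h.comp (f := fun a : EReal => ((l : EReal), a)) (by fun_prop)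

lemma coe_mul_mono {l : ℝ} (hl : 0 < l) : Monotone (fun a : EReal => (l : EReal) * a) := by
  intro a b hab
  exact mul_le_mul_of_nonneg_left hab (by exact_mod_cast hl.le)

lemma coe_mul_distrib {l : ℝ} (hl : 0 < l) (a b : EReal) :
    (l : EReal) * (a + b) = l * a + l * b :=
  EReal.left_distrib_of_nonneg_of_ne_top (by exact_mod_cast hl.le) (EReal.coe_ne_top l) a b

lemma coe_inv_mul_self {l : ℝ} (hl : 0 < l) (a : EReal) :
    (l : EReal) * ((l⁻¹ : ℝ) * a) = a := by
  rw [← mul_assoc, ← EReal.coe_mul, mul_inv_cancel₀ hl.ne', EReal.coe_one, one_mul]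

lemma epiMul_sup {l : ℝ} (hl : 0 < l) (u v : Vn n → EReal) :
    epiMul l (u ⊔ v) = epiMul l u ⊔ epiMul l v := by
  funext x
  simp only [epiMul_apply hl, Pi.sup_apply]
  exact (coe_mul_mono hl).map_sup _ _

lemma epiMul_inf {l : ℝ} (hl : 0 < l) (u v : Vn n → EReal) :
    epiMul l (u ⊓ v) = epiMul l u ⊓ epiMul l v := by
  funext x
  simp only [epiMul_apply hl, Pi.inf_apply]
  exact (coe_mul_mono hl).map_inf _ _

lemma epiMul_epiMul {l m : ℝ} (hl : 0 < l) (hm : 0 < m) (u : Vn n → EReal) :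
    epiMul l (epiMul m u) = epiMul (l * m) u := by
  funext x
  rw [epiMul_apply hl, epiMul_apply hm, epiMul_apply (mul_pos hl hm), ← mul_assoc,
    ← EReal.coe_mul, smul_smul, mul_inv_rev]

lemma epiMul_one (u : Vn n → EReal) : epiMul 1 u = u := by
  funext x
  rw [epiMul_apply one_pos]; simp

lemma epiMul_trans {l : ℝ} (hl : 0 < l) (u : Vn n → EReal) (x₀ : Vn n) (c : ℝ) :
    epiMul l (fun x => u (x - x₀) + (c : EReal)) =
      fun x => epiMul l u (x - l • x₀) + ((l * c : ℝ) : EReal) := by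
  funext x
  rw [epiMul_apply hl, epiMul_apply hl, coe_mul_distrib hl, smul_sub, smul_smul,
    inv_mul_cancel₀ hl.ne', one_smul, EReal.coe_mul]

lemma epiMul_mem {l : ℝ} (hl : 0 < l) {u : Vn n → EReal} (hu : u ∈ ConvSc n) :
    epiMul l u ∈ ConvSc n := by
  obtain ⟨⟨hc, hlsc, hb, x0, hx0⟩, hsc⟩ := hu
  refine ⟨⟨?_, ?_, ?_, ?_⟩, ?_⟩
  · intro x y t ht0 ht1
    have h := coe_mul_mono hl (hc (l⁻¹ • x) (l⁻¹ • y) t ht0 ht1)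
    simp only [epiMul_apply hl] at h ⊢
    rw [coe_mul_distrib hl, mul_left_comm, mul_left_comm (l : EReal)] at h
    convert h using 3
    rw [smul_add, smul_comm l⁻¹ t, smul_comm l⁻¹ (1 - t)]
  · have : epiMul l u = (fun a : EReal => (l : EReal) * a) ∘ (u ∘ fun x => l⁻¹ • x) := by
      funext x; exact epiMul_apply hl u x
    rw [this]
    exact (coe_mul_cont hl).comp_lowerSemicontinuous (LowerSemicontinuous.comp hlsc (by fun_prop))
      (coe_mul_mono hl)
  · intro x h
    rw [epiMul_apply hl] at h
    apply hb (l⁻¹ • x)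
    have h2 := congrArg (fun a => ((l⁻¹ : ℝ) : EReal) * a) h
    simp only [← mul_assoc, ← EReal.coe_mul, inv_mul_cancel₀ hl.ne', EReal.coe_one, one_mul,
      EReal.coe_mul_bot_of_pos (inv_pos.2 hl)] at h2
    exact h2
  · refine ⟨l • x0, fun h => hx0 ?_⟩
    rw [epiMul_apply hl, smul_smul, inv_mul_cancel₀ hl.ne', one_smul] at h
    have h2 := congrArg (fun a => ((l⁻¹ : ℝ) : EReal) * a) h
    simp only [← mul_assoc, ← EReal.coe_mul, inv_mul_cancel₀ hl.ne', EReal.coe_one, one_mul,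
      EReal.coe_mul_top_of_pos (inv_pos.2 hl)] at h2
    exact h2
  · intro M
    obtain ⟨R, hR⟩ := hsc M
    refine ⟨l * R, fun x hx => ?_⟩
    have hnorm : ‖l⁻¹ • x‖ = l⁻¹ * ‖x‖ := by
      rw [norm_smul, Real.norm_of_nonneg (inv_pos.2 hl).le]
    have h := coe_mul_mono hl (hR (l⁻¹ • x) (by
      rw [hnorm, inv_mul_eq_div, le_div_iff₀ hl]; linarith))
    simp only at h
    rw [epiMul_apply hl]
    refine le_trans (le_of_eq ?_) h
    rw [hnorm, ← EReal.coe_mul]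
    congr 1
    field_simp

lemma epiMul_epi {l : ℝ} (hl : 0 < l) {uk : ℕ → Vn n → EReal} {u : Vn n → EReal}
    (h : EpiConverges uk u) : EpiConverges (fun k => epiMul l (uk k)) (epiMul l u) := by
  intro x
  obtain ⟨h1, h2⟩ := h (l⁻¹ • x)
  constructor
  · intro xk hxk
    have := coe_mul_mono hl (h1 (fun k => l⁻¹ • xk k) (hxk.const_smul l⁻¹))
    simp only [epiMul_apply hl]
    refine this.trans (le_of_eq ?_)
    exact Monotone.map_liminf_of_continuousAt (coe_mul_mono hl) _ (coe_mul_cont hl).continuousAt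
  · obtain ⟨xk, hxk, ht⟩ := h2
    refine ⟨fun k => l • xk k, ?_, ?_⟩
    · have := hxk.const_smul l
      rwa [smul_smul, mul_inv_cancel₀ hl.ne', one_smul] at this
    · simp only [epiMul_apply hl, smul_smul, inv_mul_cancel₀ hl.ne', one_smul]
      exact ((coe_mul_cont hl).tendsto _).comp ht

variable {Z : (Vn n → EReal) → ℝ}

lemma cont_epiMul (h : ContinuousVal (ConvSc n) Z) {l : ℝ} (hl : 0 < l) :
    ContinuousVal (ConvSc n) (fun u => Z (epiMul l u)) := by
  intro uk u huk hu he
  exact h _ _ (fun k => epiMul_mem hl (huk k)) (epiMul_mem hl hu) (epiMul_epi hl he)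

lemma val_epiMul (h : IsValuation (ConvSc n) Z) {l : ℝ} (hl : 0 < l) :
    IsValuation (ConvSc n) (fun u => Z (epiMul l u)) := by
  intro u v hu hv hs hi
  simp only
  have := h (epiMul l u) (epiMul l v) (epiMul_mem hl hu) (epiMul_mem hl hv)
    (by rw [← epiMul_sup hl]; exact epiMul_mem hl hs)
    (by rw [← epiMul_inf hl]; exact epiMul_mem hl hi)
  rwa [← epiMul_sup hl, ← epiMul_inf hl] at this

lemma inv_epiMul (h : EpiTranslationInvariant (ConvSc n) Z) {l : ℝ} (hl : 0 < l) :
    EpiTranslationInvariant (ConvSc n) (fun u => Z (epiMul l u)) := by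
  intro u hu x₀ c
  simp only
  rw [epiMul_trans hl]
  exact h _ (epiMul_mem hl hu) _ _

lemma cont_sum {ι : Type*} (s : Finset ι) (a : ι → ℝ) (Y : ι → (Vn n → EReal) → ℝ)
    (h : ∀ i ∈ s, ContinuousVal (ConvSc n) (Y i)) :
    ContinuousVal (ConvSc n) (fun u => ∑ i ∈ s, a i * Y i u) := by
  intro uk u huk hu he
  exact tendsto_finsetSum _ fun i hi => (h i hi uk u huk hu he).const_mul (a i)

lemma val_sum {ι : Type*} (s : Finset ι) (a : ι → ℝ) (Y : ι → (Vn n → EReal) → ℝ)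
    (h : ∀ i ∈ s, IsValuation (ConvSc n) (Y i)) :
    IsValuation (ConvSc n) (fun u => ∑ i ∈ s, a i * Y i u) := by
  intro u v hu hv hs hi
  simp only [← Finset.sum_add_distrib]
  refine Finset.sum_congr rfl fun i hi' => ?_
  rw [← mul_add, ← mul_add, h i hi' u v hu hv hs hi]

lemma inv_sum {ι : Type*} (s : Finset ι) (a : ι → ℝ) (Y : ι → (Vn n → EReal) → ℝ)
    (h : ∀ i ∈ s, EpiTranslationInvariant (ConvSc n) (Y i)) :
    EpiTranslationInvariant (ConvSc n) (fun u => ∑ i ∈ s, a i * Y i u) := by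
  intro u hu x₀ c
  refine Finset.sum_congr rfl fun i hi' => ?_
  rw [h i hi' u hu]

end Epi

section Indic

variable {n : ℕ}

open Classical in
/-- The function equal to `h` on `K` and `+∞` elsewhere. -/
def hI (h : Vn n → ℝ) (K : Set (Vn n)) : Vn n → EReal :=
  fun x => if x ∈ K then (h x : EReal) else ⊤

lemma hI_mem' {h : Vn n → ℝ} {K : Set (Vn n)} {x : Vn n} (hx : x ∈ K) : hI h K x = (h x : EReal) :=
  if_pos hx

lemma hI_not {h : Vn n → ℝ} {K : Set (Vn n)} {x : Vn n} (hx : x ∉ K) : hI h K x = ⊤ :=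
  if_neg hx

lemma le_hI (h : Vn n → ℝ) (K : Set (Vn n)) (x : Vn n) : (h x : EReal) ≤ hI h K x := by
  by_cases hx : x ∈ K
  · rw [hI_mem' hx]
  · rw [hI_not hx]; exact le_top

lemma hI_ne_bot (h : Vn n → ℝ) (K : Set (Vn n)) (x : Vn n) : hI h K x ≠ ⊥ := by
  intro hh
  have := le_hI h K x
  rw [hh, le_bot_iff] at this
  exact EReal.coe_ne_bot _ this

lemma hI_union (h : Vn n → ℝ) (K L : Set (Vn n)) : hI h (K ∪ L) = hI h K ⊓ hI h L := by
  funext x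
  rw [Pi.inf_apply]
  by_cases hK : x ∈ K <;> by_cases hL : x ∈ L <;> simp [hI, hK, hL]

lemma hI_inter (h : Vn n → ℝ) (K L : Set (Vn n)) : hI h (K ∩ L) = hI h K ⊔ hI h L := by
  funext x
  rw [Pi.sup_apply]
  by_cases hK : x ∈ K <;> by_cases hL : x ∈ L <;> simp [hI, hK, hL]

lemma hI_congr {h g : Vn n → ℝ} {K : Set (Vn n)} (e : ∀ x ∈ K, h x = g x) : hI h K = hI g K := by
  funext x
  by_cases hK : x ∈ K
  · rw [hI_mem' hK, hI_mem' hK, e x hK]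
  · rw [hI_not hK, hI_not hK]

lemma hI_mem {h : Vn n → ℝ} (hc : Continuous h) (hconv : ConvexOn ℝ Set.univ h) {K : Set (Vn n)}
    (hK : IsBody K) : hI h K ∈ ConvSc n := by
  refine ⟨⟨?_, ?_, hI_ne_bot h K, ?_⟩, ?_⟩
  · intro x y t ht0 ht1
    have ht1' : 0 < 1 - t := by linarith
    have nb : ∀ (s : ℝ), 0 < s → ∀ z, (s : EReal) * hI h K z ≠ ⊥ := by
      intro s hs z
      by_cases hz : z ∈ K
      · rw [hI_mem' hz, ← EReal.coe_mul]; exact EReal.coe_ne_bot _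
      · rw [hI_not hz, EReal.coe_mul_top_of_pos hs]; exact bot_ne_top.symm
    by_cases hx : x ∈ K
    · by_cases hy : y ∈ K
      · rw [hI_mem' hx, hI_mem' hy, hI_mem' (hK.convex hx hy ht0.le ht1'.le (by ring)),
          ← EReal.coe_mul, ← EReal.coe_mul, ← EReal.coe_add, EReal.coe_le_coe_iff]
        exact hconv.2 (Set.mem_univ x) (Set.mem_univ y) ht0.le ht1'.le (by ring)
      · rw [hI_not hy, EReal.coe_mul_top_of_pos ht1', EReal.add_top_iff_ne_bot.2 (nb t ht0 x)]
        exact le_top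
    · rw [hI_not hx, EReal.coe_mul_top_of_pos ht0, EReal.top_add_iff_ne_bot.2 (nb _ ht1' y)]
      exact le_top
  · intro x y hxy
    by_cases hx : x ∈ K
    · rw [hI_mem' hx] at hxy
      have hcc : Continuous (fun x => (h x : EReal)) := continuous_coe_real_ereal.comp hc
      filter_upwards [(tendsto_order.1 (hcc.tendsto x)).1 y hxy] with z hz
      exact hz.trans_le (le_hI h K z)
    · rw [hI_not hx] at hxy
      filter_upwards [hK.compact.isClosed.isOpen_compl.mem_nhds hx] with z hz
      rwa [hI_not hz]
  · obtain ⟨x, hx⟩ := hK.nonempty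
    exact ⟨x, by rw [hI_mem' hx]; exact EReal.coe_ne_top _⟩
  · intro M
    obtain ⟨R, hR⟩ := hK.compact.isBounded.exists_norm_le
    refine ⟨R + 1, fun x hx => ?_⟩
    rw [hI_not (fun hxK => by have := hR x hxK; linarith)]
    exact le_top

lemma hI_epi {h : Vn n → ℝ} (hc : Continuous h) (Ks : ℕ → Set (Vn n)) (K : Set (Vn n))
    (hKs : ∀ i, IsBody (Ks i)) (hK : IsBody K)
    (hd : Tendsto (fun i => Metric.hausdorffDist (Ks i) K) atTop (𝓝 0)) :
    EpiConverges (fun i => hI h (Ks i)) (hI h K) := by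
  have hcc : Continuous (fun x => (h x : EReal)) := continuous_coe_real_ereal.comp hc
  have hfin : ∀ i, Metric.hausdorffEDist (Ks i) K ≠ ⊤ := fun i =>
    Metric.hausdorffEDist_ne_top_of_nonempty_of_bounded (hKs i).nonempty hK.nonempty
      (hKs i).compact.isBounded hK.compact.isBounded
  have hout : ∀ x, x ∉ K → ∀ xk : ℕ → Vn n, Tendsto xk atTop (𝓝 x) →
      Tendsto (fun k => hI h (Ks k) (xk k)) atTop (𝓝 ⊤) := by
    intro x hx xk hxk
    have hpos : 0 < Metric.infDist x K := by
      refine lt_of_le_of_ne Metric.infDist_nonneg fun he => hx ?_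
      exact (hK.compact.isClosed.mem_iff_infDist_zero hK.nonempty).2 he.symm
    have hsum : Tendsto (fun k => dist (xk k) x + Metric.hausdorffDist (Ks k) K) atTop (𝓝 0) := by
      simpa using (tendsto_iff_dist_tendsto_zero.1 hxk).add hd
    refine tendsto_const_nhds.congr' ?_
    filter_upwards [(tendsto_order.1 hsum).2 _ hpos] with k hk
    rw [hI_not]
    intro hmem
    have h1 := Metric.infDist_le_hausdorffDist_of_mem hmem (hfin k)
    have h2 := Metric.infDist_le_infDist_add_dist (s := K) (x := x) (y := xk k)
    rw [dist_comm] at h2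
    linarith
  intro x
  constructor
  · intro xk hxk
    by_cases hx : x ∈ K
    · rw [hI_mem' hx, ← ((hcc.tendsto x).comp hxk).liminf_eq]
      exact liminf_le_liminf (Eventually.of_forall fun k => le_hI h _ _)
    · rw [(hout x hx xk hxk).liminf_eq]
      exact le_top
  · by_cases hx : x ∈ K
    · have : ∀ k : ℕ, ∃ y ∈ Ks k, dist y x < Metric.hausdorffDist (Ks k) K + 1 / ((k : ℝ) + 1) := by
        intro k
        have hp : (0 : ℝ) < 1 / ((k : ℝ) + 1) := by positivity
        exact Metric.exists_dist_lt_of_hausdorffDist_lt' hx (by linarith) (hfin k)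
      choose xk hxk hxd using this
      have ht : Tendsto xk atTop (𝓝 x) := by
        rw [tendsto_iff_dist_tendsto_zero]
        refine squeeze_zero (fun k => dist_nonneg) (fun k => (hxd k).le) ?_
        simpa using hd.add tendsto_one_div_add_atTop_nhds_zero_nat
      refine ⟨xk, ht, ?_⟩
      simp only [hI_mem' (hxk _), hI_mem' hx]
      exact (hcc.tendsto x).comp ht
    · refine ⟨fun _ => x, tendsto_const_nhds, ?_⟩
      rw [hI_not hx]
      exact hout x hx _ tendsto_const_nhds

end Indic

section Density

variable {n : ℕ}

/-- Affine functions, parametrized by slope and intercept. -/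
def affq (q : (Vn n →L[ℝ] ℝ) × ℝ) (x : Vn n) : ℝ := q.1 x + q.2

lemma affq_cont (q : (Vn n →L[ℝ] ℝ) × ℝ) : Continuous (affq q) := by
  unfold affq; fun_prop

lemma affq_comb (q : (Vn n →L[ℝ] ℝ) × ℝ) (x y : Vn n) (a b : ℝ) (hab : a + b = 1) :
    affq q (a • x + b • y) = a * affq q x + b * affq q y := by
  simp only [affq, map_add, map_smul, smul_eq_mul]
  have : q.2 = a * q.2 + b * q.2 := by rw [← add_mul, hab, one_mul]
  linarith

lemma affq_aff (q : (Vn n →L[ℝ] ℝ) × ℝ) : IsAff (affq q) := ⟨affq_cont q, affq_comb q⟩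

lemma affq_convex (q : (Vn n →L[ℝ] ℝ) × ℝ) : ConvexOn ℝ Set.univ (affq q) :=
  ⟨convex_univ, fun x _ y _ a b _ _ hab => (affq_comb q x y a b hab).le⟩

lemma affq_sub_aff (q r : (Vn n →L[ℝ] ℝ) × ℝ) : IsAff (fun x => affq q x - affq r x) :=
  ⟨(affq_cont q).sub (affq_cont r), fun x y a b hab => by
    simp only [affq_comb q x y a b hab, affq_comb r x y a b hab]; ring⟩

/-- Maximum of finitely many affine functions. -/
def maxq (S : Finset ((Vn n →L[ℝ] ℝ) × ℝ)) (hS : S.Nonempty) (x : Vn n) : ℝ :=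
  S.sup' hS (fun q => affq q x)

lemma maxq_cont (S : Finset ((Vn n →L[ℝ] ℝ) × ℝ)) (hS : S.Nonempty) : Continuous (maxq S hS) :=
  Continuous.finset_sup'_apply hS (fun q _ => affq_cont q)

lemma maxq_convex (S : Finset ((Vn n →L[ℝ] ℝ) × ℝ)) (hS : S.Nonempty) :
    ConvexOn ℝ Set.univ (maxq S hS) := by
  refine ⟨convex_univ, fun x _ y _ a b ha hb hab => ?_⟩
  refine Finset.sup'_le hS _ fun q hq => ?_
  rw [affq_comb q x y a b hab]
  have h1 : affq q x ≤ maxq S hS x := Finset.le_sup' (fun q => affq q x) hq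
  have h2 : affq q y ≤ maxq S hS y := Finset.le_sup' (fun q => affq q y) hq
  have i1 := mul_le_mul_of_nonneg_left h1 ha
  have i2 := mul_le_mul_of_nonneg_left h2 hb
  simp only [smul_eq_mul]
  linarith

lemma approx_hull {E : Type*} [NormedAddCommGroup E] [NormedSpace ℝ E] {K : Set E}
    (hK : IsBody K) : ∃ t : ℕ → Finset E, (∀ i, (t i).Nonempty) ∧
      Tendsto (fun i => Metric.hausdorffDist (convexHull ℝ (t i : Set E)) K) atTop (𝓝 0) := by
  have : ∀ i : ℕ, ∃ t : Finset E, t.Nonempty ∧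
      Metric.hausdorffDist (convexHull ℝ (t : Set E)) K ≤ 1 / ((i : ℝ) + 1) := by
    intro i
    have hp : (0 : ℝ) < 1 / ((i : ℝ) + 1) := by positivity
    obtain ⟨t, htK, htf, hcov⟩ := hK.compact.finite_cover_balls hp
    refine ⟨htf.toFinset, ?_, ?_⟩
    · obtain ⟨x, hx⟩ := hK.nonempty
      obtain ⟨y, hy, -⟩ := Set.mem_iUnion₂.1 (hcov hx)
      exact ⟨y, by simpa using hy⟩
    · rw [Set.Finite.coe_toFinset]
      refine Metric.hausdorffDist_le_of_mem_dist hp.le ?_ ?_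
      · intro x hx
        exact ⟨x, convexHull_min htK hK.convex hx, by simpa using hp.le⟩
      · intro x hx
        obtain ⟨y, hy, hxy⟩ := Set.mem_iUnion₂.1 (hcov hx)
        exact ⟨y, subset_convexHull ℝ t hy, (Metric.mem_ball.1 hxy).le⟩
  choose t ht hd using this
  exact ⟨t, ht, squeeze_zero (fun i => Metric.hausdorffDist_nonneg) hd
    tendsto_one_div_add_atTop_nhds_zero_nat⟩

variable {W : (Vn n → EReal) → ℝ}

lemma vanish_body (hc : ContinuousVal (ConvSc n) W) (q : (Vn n →L[ℝ] ℝ) × ℝ)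
    (h : ∀ t : Finset (Vn n), t.Nonempty → W (hI (affq q) (convexHull ℝ (t : Set (Vn n)))) = 0)
    {K : Set (Vn n)} (hK : IsBody K) : W (hI (affq q) K) = 0 := by
  obtain ⟨t, ht, hd⟩ := approx_hull hK
  have := hc _ _ (fun i => hI_mem (affq_cont q) (affq_convex q) (hull_body (t i) (ht i)))
    (hI_mem (affq_cont q) (affq_convex q) hK)
    (hI_epi (affq_cont q) _ K (fun i => hull_body (t i) (ht i)) hK hd)
  simp only [h _ (ht _)] at this
  exact tendsto_nhds_unique this tendsto_const_nhds

open Classical in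
lemma maxq_erase (S : Finset ((Vn n →L[ℝ] ℝ) × ℝ)) (hS : S.Nonempty)
    {a b : (Vn n →L[ℝ] ℝ) × ℝ} (hb : b ∈ S) (hab : a ≠ b) (hE : (S.erase a).Nonempty)
    {x : Vn n} (hx : affq a x ≤ affq b x) : maxq S hS x = maxq (S.erase a) hE x := by
  refine le_antisymm (Finset.sup'_le hS _ fun q hq => ?_) (Finset.sup'_mono _ (S.erase_subset a) hE)
  by_cases hqa : q = a
  · rw [hqa]
    exact hx.trans (Finset.le_sup' (fun q => affq q x) (Finset.mem_erase.2 ⟨hab.symm, hb⟩))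
  · exact Finset.le_sup' (fun q => affq q x) (Finset.mem_erase.2 ⟨hqa, hq⟩)

open Classical in
lemma vanish_max (hv : IsValuation (ConvSc n) W)
    (h : ∀ q, ∀ K : Set (Vn n), IsBody K → W (hI (affq q) K) = 0) (k : ℕ) :
    ∀ (S : Finset ((Vn n →L[ℝ] ℝ) × ℝ)) (hS : S.Nonempty), S.card = k + 1 →
      ∀ K : Set (Vn n), IsBody K → W (hI (maxq S hS) K) = 0 := by
  induction k with
  | zero =>
    intro S hS hcard K hK
    obtain ⟨a, rfl⟩ := Finset.card_eq_one.1 hcard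
    have : maxq {a} hS = affq a := by
      funext x; simp [maxq]
    rw [this]
    exact h a K hK
  | succ k ih =>
    intro S hS hcard K hK
    obtain ⟨a, ha, b, hb, hab⟩ := Finset.one_lt_card.1 (by omega : 1 < S.card)
    have ca : (S.erase a).card = k + 1 := by rw [Finset.card_erase_of_mem ha]; omega
    have cb : (S.erase b).card = k + 1 := by rw [Finset.card_erase_of_mem hb]; omega
    have hEa : (S.erase a).Nonempty := ⟨b, Finset.mem_erase.2 ⟨hab.symm, hb⟩⟩
    have hEb : (S.erase b).Nonempty := ⟨a, Finset.mem_erase.2 ⟨hab, ha⟩⟩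
    have low : ∀ L : Set (Vn n), IsBody L → (∀ x ∈ L, affq a x - affq b x ≤ 0) →
        W (hI (maxq S hS) L) = 0 := by
      intro L hL hLx
      rw [hI_congr fun x hx => maxq_erase S hS hb hab hEa (by have := hLx x hx; linarith)]
      exact ih _ hEa ca L hL
    have high : ∀ L : Set (Vn n), IsBody L → (∀ x ∈ L, 0 ≤ affq a x - affq b x) →
        W (hI (maxq S hS) L) = 0 := by
      intro L hL hLx
      rw [hI_congr fun x hx => maxq_erase S hS ha hab.symm hEb (by have := hLx x hx; linarith)]
      exact ih _ hEb cb L hL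
    by_cases h1 : ∃ x ∈ K, affq a x - affq b x ≤ 0
    · by_cases h2 : ∃ x ∈ K, 0 ≤ affq a x - affq b x
      · have b1 := hK.le_body (affq_sub_aff a b) 0 h1
        have b2 := hK.ge_body (affq_sub_aff a b) 0 h2
        have hi := hK.cut_inter (affq_sub_aff a b) 0 h1 h2
        have hm : ∀ L : Set (Vn n), IsBody L → hI (maxq S hS) L ∈ ConvSc n :=
          fun L hL => hI_mem (maxq_cont S hS) (maxq_convex S hS) hL
        have hu := IsBody.cut_union (K := K) (fun x => affq a x - affq b x) 0
        have hb12 := b1.inter b2 hi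
        have key := hv _ _ (hm _ b1) (hm _ b2)
          (by rw [← hI_inter]; exact hm _ hb12) (by rw [← hI_union, hu]; exact hm _ hK)
        rw [← hI_inter, ← hI_union, hu, low _ b1 (fun x hx => hx.2),
          high _ b2 (fun x hx => hx.2), low _ hb12 (fun x hx => hx.1.2)] at key
        linarith
      · push Not at h2
        exact low K hK (fun x hx => (h2 x hx).le)
    · push Not at h1
      exact high K hK (fun x hx => (h1 x hx).le)

/-- Nonvertical separation: minorant or vertical hyperplane. -/
lemma sep {u : Vn n → EReal} (hu : u ∈ ConvSet n) (x : Vn n) (r : ℝ) (hr : (r : EReal) < u x) :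
    (∃ q, (∀ z, (affq q z : EReal) ≤ u z) ∧ r < affq q x) ∨
    (∃ q, (∀ z, u z ≠ ⊤ → affq q z < 0) ∧ 0 < affq q x) := by
  obtain ⟨hc, hlsc, hb, x0, hx0⟩ := hu
  let t : Set (Vn n × ℝ) := {p | u p.1 ≤ (p.2 : EReal)}
  have htc : Convex ℝ t := by
    rw [convex_iff_forall_pos]
    rintro ⟨z, s⟩ hz ⟨w, s'⟩ hw a b ha hbb hab
    have hb1 : b = 1 - a := by linarith
    subst hb1
    have h := hc z w a ha (by linarith)
    have h1 : (a : EReal) * u z ≤ a * (s : EReal) :=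
      mul_le_mul_of_nonneg_left hz (by exact_mod_cast ha.le)
    have h2 : ((1 - a : ℝ) : EReal) * u w ≤ ((1 - a : ℝ) : EReal) * (s' : EReal) :=
      mul_le_mul_of_nonneg_left hw (by exact_mod_cast hbb.le)
    refine h.trans ((add_le_add h1 h2).trans (le_of_eq ?_))
    simp only [Prod.snd_add, Prod.smul_snd, smul_eq_mul]
    push_cast
    rfl
  have htcl : IsClosed t := by
    have := lowerSemicontinuous_iff_isClosed_epigraph.1 hlsc
    exact this.preimage (f := fun p : Vn n × ℝ => (p.1, (p.2 : EReal)))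
      (continuous_fst.prodMk (continuous_coe_real_ereal.comp continuous_snd))
  obtain ⟨f, c, hfx, hft⟩ := geometric_hahn_banach_point_closed htc htcl
    (x := (x, r)) (fun hmem => absurd hr (not_lt.2 hmem))
  set L : Vn n →L[ℝ] ℝ := f.comp (ContinuousLinearMap.inl ℝ (Vn n) ℝ) with hL
  set β : ℝ := f (0, 1) with hβ
  have hf : ∀ z s, f (z, s) = L z + s * β := by
    intro z s
    have : (z, s) = (z, 0) + s • ((0 : Vn n), (1 : ℝ)) := by simp
    rw [this, map_add, map_smul]
    simp [hL, hβ]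
  have hreal : ∀ z, u z ≠ ⊤ → ∀ s : ℝ, (u z).toReal ≤ s → c < L z + s * β := by
    intro z hz s hs
    rw [← hf]
    apply hft
    show u z ≤ (s : EReal)
    rw [← EReal.coe_toReal hz (hb z)]
    exact_mod_cast hs
  rw [hf] at hfx
  have hβ0 : 0 ≤ β := by
    by_contra hneg
    push Not at hneg
    have h1 := hreal x0 hx0 (max (u x0).toReal ((c - L x0) / β)) (le_max_left _ _)
    have h2 := mul_le_mul_of_nonpos_right (le_max_right (u x0).toReal ((c - L x0) / β)) hneg.le
    rw [div_mul_cancel₀ _ hneg.ne] at h2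
    linarith
  rcases hβ0.eq_or_lt with h0 | hpos
  · right
    refine ⟨(-L, c), fun z hz => ?_, ?_⟩
    · have := hreal z hz _ le_rfl
      rw [← h0] at this
      simp only [affq, neg_apply]
      linarith
    · rw [← h0] at hfx
      simp only [affq, neg_apply]
      linarith
  · left
    have he : ∀ z, affq (-(β⁻¹ • L), β⁻¹ * c) z = (c - L z) / β := by
      intro z
      simp only [affq, neg_apply, smul_apply, smul_eq_mul]
      field_simp; ring
    refine ⟨(-(β⁻¹ • L), β⁻¹ * c), fun z => ?_, ?_⟩
    · by_cases hz : u z = ⊤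
      · rw [hz]; exact le_top
      · have := hreal z hz _ le_rfl
        rw [← EReal.coe_toReal hz (hb z), EReal.coe_le_coe_iff, he, div_le_iff₀ hpos]
        linarith
    · rw [he, lt_div_iff₀ hpos]
      linarith

lemma minorant {u : Vn n → EReal} (hu : u ∈ ConvSet n) (x : Vn n) (r : ℝ) (hr : (r : EReal) < u x) :
    ∃ q, (∀ z, (affq q z : EReal) ≤ u z) ∧ r < affq q x := by
  rcases sep hu x r hr with h | ⟨q, hq1, hq2⟩
  · exact h
  obtain ⟨hc, hlsc, hb, x0, hx0⟩ := id hu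
  have hx0' : (((u x0).toReal - 1 : ℝ) : EReal) < u x0 := by
    rw [← EReal.coe_toReal hx0 (hb x0), EReal.coe_lt_coe_iff, EReal.toReal_coe]
    linarith
  obtain ⟨q0, hq0, -⟩ : ∃ q, (∀ z, (affq q z : EReal) ≤ u z) ∧ _ < affq q x0 := by
    rcases sep hu x0 _ hx0' with h | ⟨q, h1, h2⟩
    · exact h
    · exact absurd (h1 x0 hx0) (not_lt.2 h2.le)
  obtain ⟨N, hN⟩ := exists_nat_gt ((r - affq q0 x) / affq q x)
  have hN' : r - affq q0 x < N * affq q x := (div_lt_iff₀ hq2).1 hN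
  have he : ∀ z, affq (q0 + (N : ℝ) • q) z = affq q0 z + N * affq q z := by
    intro z
    simp only [affq, Prod.fst_add, Prod.snd_add, Prod.smul_fst, Prod.smul_snd,
      add_apply, smul_apply, smul_eq_mul]
    ring
  refine ⟨q0 + (N : ℝ) • q, fun z => ?_, ?_⟩
  · by_cases hz : u z = ⊤
    · rw [hz]; exact le_top
    · refine le_trans ?_ (hq0 z)
      rw [EReal.coe_le_coe_iff, he]
      have := mul_nonneg (Nat.cast_nonneg (α := ℝ) N) (neg_nonneg.2 (hq1 z hz).le)
      linarith
  · rw [he]; linarith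

lemma minorant_seq {u : Vn n → EReal} (hu : u ∈ ConvSet n) :
    ∃ q : ℕ → (Vn n →L[ℝ] ℝ) × ℝ, (∀ i z, (affq (q i) z : EReal) ≤ u z) ∧
      ∀ (x : Vn n) (r : ℝ), (r : EReal) < u x → ∃ i, r < affq (q i) x := by
  let M : Set ((Vn n →L[ℝ] ℝ) × ℝ) := {q | ∀ z, (affq q z : EReal) ≤ u z}
  obtain ⟨hc, hlsc, hb, x0, hx0⟩ := id hu
  have hx0' : (((u x0).toReal - 1 : ℝ) : EReal) < u x0 := by
    rw [← EReal.coe_toReal hx0 (hb x0), EReal.coe_lt_coe_iff, EReal.toReal_coe]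
    linarith
  obtain ⟨q0, hq0, -⟩ := minorant hu x0 _ hx0'
  have : Nonempty M := ⟨⟨q0, hq0⟩⟩
  refine ⟨fun i => (TopologicalSpace.denseSeq M i : M), fun i => (TopologicalSpace.denseSeq M i).2,
    fun x r hr => ?_⟩
  obtain ⟨q, hq, hqx⟩ := minorant hu x r hr
  have hcont : Continuous (fun q : M => affq (q : (Vn n →L[ℝ] ℝ) × ℝ) x) := by
    unfold affq
    fun_prop
  obtain ⟨i, hi⟩ := (TopologicalSpace.denseRange_denseSeq M).exists_mem_open
    (isOpen_lt continuous_const hcont) ⟨⟨q, hq⟩, hqx⟩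
  exact ⟨i, hi⟩

end Density

section Final

variable {n : ℕ}

lemma vanish_all {W : (Vn n → EReal) → ℝ} (hc : ContinuousVal (ConvSc n) W)
    (hv : IsValuation (ConvSc n) W)
    (h : ∀ q, ∀ t : Finset (Vn n), t.Nonempty →
      W (hI (affq q) (convexHull ℝ (t : Set (Vn n)))) = 0)
    {u : Vn n → EReal} (hu : u ∈ ConvSc n) : W u = 0 := by
  classical
  obtain ⟨q, hq, hsup⟩ := minorant_seq hu.1
  let S : ℕ → Finset ((Vn n →L[ℝ] ℝ) × ℝ) := fun k => (Finset.range (k + 1)).image q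
  have hS : ∀ k, (S k).Nonempty := fun k => (Finset.nonempty_range_add_one).image q
  have hB : ∀ k : ℕ, IsBody (Metric.closedBall (0 : Vn n) (k : ℝ)) := fun k =>
    ⟨isCompact_closedBall _ _, convex_closedBall _ _,
      ⟨0, Metric.mem_closedBall_self (Nat.cast_nonneg k)⟩⟩
  let uk : ℕ → Vn n → EReal := fun k => hI (maxq (S k) (hS k)) (Metric.closedBall 0 (k : ℝ))
  have hge : ∀ i k, i ≤ k → ∀ x, (affq (q i) x : EReal) ≤ uk k x := by
    intro i k hik x
    refine le_trans ?_ (le_hI _ _ x)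
    rw [EReal.coe_le_coe_iff]
    exact Finset.le_sup' (fun p => affq p x)
      (Finset.mem_image_of_mem q (Finset.mem_range.2 (by omega)))
  have hlow : ∀ x, ∀ xk : ℕ → Vn n, Tendsto xk atTop (𝓝 x) →
      u x ≤ liminf (fun k => uk k (xk k)) atTop := by
    intro x xk hxk
    refine le_of_forall_lt fun y hy => ?_
    obtain ⟨r, hyr, hr⟩ := EReal.lt_iff_exists_real_btwn.1 hy
    obtain ⟨i, hi⟩ := hsup x r hr
    have hcc : Continuous (fun x => (affq (q i) x : EReal)) :=
      continuous_coe_real_ereal.comp (affq_cont (q i))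
    have h1 : (affq (q i) x : EReal) ≤ liminf (fun k => uk k (xk k)) atTop := by
      rw [← ((hcc.tendsto x).comp hxk).liminf_eq]
      refine liminf_le_liminf ?_
      filter_upwards [eventually_ge_atTop i] with k hk
      exact hge i k hk _
    exact hyr.trans (lt_of_lt_of_le (by exact_mod_cast hi) h1)
  have hepi : EpiConverges uk u := by
    intro x
    refine ⟨hlow x, fun _ => x, tendsto_const_nhds, ?_⟩
    refine tendsto_of_le_liminf_of_limsup_le (hlow x _ tendsto_const_nhds) ?_
    refine limsup_le_of_le (by isBoundedDefault) ?_
    obtain ⟨N, hN⟩ := exists_nat_ge ‖x‖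
    filter_upwards [eventually_ge_atTop N] with k hk
    have hmem : x ∈ Metric.closedBall (0 : Vn n) (k : ℝ) := by
      rw [mem_closedBall_zero_iff]
      exact hN.trans (by exact_mod_cast hk)
    show hI _ _ x ≤ u x
    rw [hI_mem' hmem]
    obtain ⟨p, hp, hpe⟩ := Finset.exists_mem_eq_sup' (hS k) (fun p => affq p x)
    obtain ⟨i, -, rfl⟩ := Finset.mem_image.1 hp
    unfold maxq
    rw [hpe]
    exact hq i x
  have hz : ∀ k, W (uk k) = 0 := by
    intro k
    refine vanish_max hv (fun q K hK => vanish_body hc q (h q) hK) ((S k).card - 1) (S k) (hS k)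
      ?_ _ (hB k)
    have := (hS k).card_pos
    omega
  have := hc uk u (fun k => hI_mem (maxq_cont _ _) (maxq_convex _ _) (hB k)) hu hepi
  simp only [hz] at this
  exact tendsto_nhds_unique this tendsto_const_nhds

lemma bodyVal_of {Z : (Vn n → EReal) → ℝ} (hcont : ContinuousVal (ConvSc n) Z)
    (hval : IsValuation (ConvSc n) Z) (hinv : EpiTranslationInvariant (ConvSc n) Z)
    (L : Vn n →L[ℝ] ℝ) : BodyVal (fun K => Z (hI (affq (L, 0)) K)) := by
  have hm : ∀ K : Set (Vn n), IsBody K → hI (affq (L, 0)) K ∈ ConvSc n :=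
    fun K hK => hI_mem (affq_cont _) (affq_convex _) hK
  refine ⟨?_, ?_, ?_⟩
  · intro K M hK hM hconv hne
    have hu : IsBody (K ∪ M) :=
      ⟨hK.compact.union hM.compact, hconv, hK.nonempty.mono Set.subset_union_left⟩
    have := hval _ _ (hm K hK) (hm M hM) (by rw [← hI_inter]; exact hm _ (hK.inter hM hne))
      (by rw [← hI_union]; exact hm _ hu)
    rw [← hI_inter, ← hI_union] at this
    linarith
  · intro K hK x
    rw [← hinv _ (hm K hK) x (L x)]
    congr 1
    funext z
    by_cases hz : z - x ∈ K
    · have hz2 : z ∈ (fun y => x + y) '' K := ⟨z - x, hz, by simp⟩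
      rw [hI_mem' hz, hI_mem' hz2, ← EReal.coe_add]
      congr 1
      simp [affq]
    · rw [hI_not hz, hI_not, EReal.top_add_coe]
      rintro ⟨w, hw, rfl⟩
      exact hz (by simpa using hw)
  · intro Ks K hKs hK hd
    exact hcont _ _ (fun i => hm _ (hKs i)) (hm K hK) (hI_epi (affq_cont _) Ks K hKs hK hd)

lemma Z_epiMul_affq {Z : (Vn n → EReal) → ℝ} (hinv : EpiTranslationInvariant (ConvSc n) Z)
    (q : (Vn n →L[ℝ] ℝ) × ℝ) {K : Set (Vn n)} (hK : IsBody K) {l : ℝ} (hl : 0 < l) :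
    Z (epiMul l (hI (affq q) K)) = Z (hI (affq (q.1, 0)) ((fun y => l • y) '' K)) := by
  rw [← hinv _ (hI_mem (affq_cont (q.1, 0)) (affq_convex _) (hK.smul l)) 0 (l * q.2)]
  congr 1
  funext x
  rw [epiMul_apply hl, sub_zero]
  by_cases hx : l⁻¹ • x ∈ K
  · have hx2 : x ∈ (fun y => l • y) '' K := ⟨l⁻¹ • x, hx, by simp [smul_smul, hl.ne']⟩
    rw [hI_mem' hx, hI_mem' hx2, ← EReal.coe_mul, ← EReal.coe_add]
    congr 1
    simp only [affq, map_smul, smul_eq_mul]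
    field_simp
    ring
  · rw [hI_not hx, hI_not, EReal.top_add_coe, EReal.coe_mul_top_of_pos hl]
    rintro ⟨w, hw, rfl⟩
    exact hx (by simpa [smul_smul, hl.ne'] using hw)

/-- The interpolating polynomial of `l ↦ Z (l ⊡ u)`. -/
def interpP (n : ℕ) (Z : (Vn n → EReal) → ℝ) (u : Vn n → EReal) : Polynomial ℝ :=
  Lagrange.interpolate (Finset.range (n + 1)) (fun j : ℕ => (j : ℝ) + 1)
    (fun j => Z (epiMul ((j : ℝ) + 1) u))

lemma node_inj (s : Finset ℕ) : Set.InjOn (fun j : ℕ => (j : ℝ) + 1) s := by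
  intro a _ b _ h
  simpa using h

lemma interpP_eval (Z : (Vn n → EReal) → ℝ) (u : Vn n → EReal) (l : ℝ) :
    (interpP n Z u).eval l = ∑ j ∈ Finset.range (n + 1),
      (Lagrange.basis (Finset.range (n + 1)) (fun j : ℕ => (j : ℝ) + 1) j).eval l *
        Z (epiMul ((j : ℝ) + 1) u) := by
  rw [interpP, Lagrange.interpolate_apply, Polynomial.eval_finsetSum]
  refine Finset.sum_congr rfl fun j _ => ?_
  rw [Polynomial.eval_mul, Polynomial.eval_C, mul_comm]

lemma interpP_coeff (Z : (Vn n → EReal) → ℝ) (u : Vn n → EReal) (i : ℕ) :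
    (interpP n Z u).coeff i = ∑ j ∈ Finset.range (n + 1),
      (Lagrange.basis (Finset.range (n + 1)) (fun j : ℕ => (j : ℝ) + 1) j).coeff i *
        Z (epiMul ((j : ℝ) + 1) u) := by
  rw [interpP, Lagrange.interpolate_apply, Polynomial.finsetSum_coeff]
  refine Finset.sum_congr rfl fun j _ => ?_
  rw [Polynomial.coeff_C_mul, mul_comm]

lemma interpP_correct {Z : (Vn n → EReal) → ℝ} (hcont : ContinuousVal (ConvSc n) Z)
    (hval : IsValuation (ConvSc n) Z) (hinv : EpiTranslationInvariant (ConvSc n) Z)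
    {u : Vn n → EReal} (hu : u ∈ ConvSc n) {l : ℝ} (hl : 0 < l) :
    Z (epiMul l u) = (interpP n Z u).eval l := by
  have hpos : ∀ j : ℕ, (0 : ℝ) < (j : ℝ) + 1 := fun j => by positivity
  let b : ℕ → ℝ := fun j =>
    (Lagrange.basis (Finset.range (n + 1)) (fun j : ℕ => (j : ℝ) + 1) j).eval l
  let Y : (Vn n → EReal) → ℝ := fun u =>
    ∑ j ∈ Finset.range (n + 1), b j * Z (epiMul ((j : ℝ) + 1) u)
  have hYc : ContinuousVal (ConvSc n) Y :=
    cont_sum (Finset.range (n + 1)) b (fun j u => Z (epiMul ((j : ℝ) + 1) u))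
      (fun j _ => cont_epiMul hcont (hpos j))
  have hYv : IsValuation (ConvSc n) Y :=
    val_sum (Finset.range (n + 1)) b (fun j u => Z (epiMul ((j : ℝ) + 1) u))
      (fun j _ => val_epiMul hval (hpos j))
  have hW : (fun u => Z (epiMul l u) - Y u) u = 0 := by
    refine vanish_all (W := fun u => Z (epiMul l u) - Y u) ?_ ?_ ?_ hu
    · intro uk v huk hv he
      exact (cont_epiMul hcont hl uk v huk hv he).sub (hYc uk v huk hv he)
    · intro v w hv hw hs hi
      have h1 := val_epiMul hval hl v w hv hw hs hi
      have h2 := hYv v w hv hw hs hi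
      simp only at h1 ⊢
      linarith
    · intro q t ht
      obtain ⟨p, hpd, hp⟩ := polytope_poly_deg (bodyVal_of hcont hval hinv q.1) t ht
      have hZ : ∀ s : ℝ, 0 < s →
          Z (epiMul s (hI (affq q) (convexHull ℝ (t : Set (Vn n))))) = p.eval s := by
        intro s hs
        rw [Z_epiMul_affq hinv q (hull_body t ht) hs]
        exact hp s hs.le
      have hdeg : p.degree < (Finset.range (n + 1)).card := by
        rw [Finset.card_range]
        exact lt_of_le_of_lt (Polynomial.degree_le_of_natDegree_le hpd)
          (by exact_mod_cast Nat.lt_succ_self n)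
      have hint : p = interpP n Z (hI (affq q) (convexHull ℝ (t : Set (Vn n)))) :=
        Lagrange.eq_interpolate_of_eval_eq _ (node_inj _) hdeg (fun j _ => (hZ _ (hpos j)).symm)
      have he := interpP_eval Z (hI (affq q) (convexHull ℝ (t : Set (Vn n)))) l
      rw [← hint] at he
      simp only [Y, b]
      rw [hZ l hl, he, sub_self]
  simp only at hW
  rw [interpP_eval]
  exact sub_eq_zero.1 hW

end Final

/-- **Homogeneous decomposition** (Theorem 1): every continuous and
epi-translation invariant valuation on `Conv_sc(ℝⁿ)` is the sum of continuous
and epi-translation invariant valuations `Z₀, …, Z_n` with `Z_i`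
epi-homogeneous of degree `i`. -/
theorem homogeneous_decomposition_sc (n : ℕ) (Z : (Vn n → EReal) → ℝ)
    (hcont : ContinuousVal (ConvSc n) Z)
    (hval : IsValuation (ConvSc n) Z)
    (hinv : EpiTranslationInvariant (ConvSc n) Z) :
    ∃ Zs : Fin (n + 1) → (Vn n → EReal) → ℝ,
      (∀ i : Fin (n + 1),
        ContinuousVal (ConvSc n) (Zs i) ∧
        IsValuation (ConvSc n) (Zs i) ∧
        EpiTranslationInvariant (ConvSc n) (Zs i) ∧
        EpiHomogeneous (ConvSc n) (Zs i) ((i : ℕ) : ℝ)) ∧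
      ∀ u ∈ ConvSc n, Z u = ∑ i : Fin (n + 1), Zs i u := by
  classical
  have hpos : ∀ j : ℕ, (0 : ℝ) < (j : ℝ) + 1 := fun j => by positivity
  let b : ℕ → ℕ → ℝ := fun i j =>
    (Lagrange.basis (Finset.range (n + 1)) (fun j : ℕ => (j : ℝ) + 1) j).coeff i
  refine ⟨fun i u => ∑ j ∈ Finset.range (n + 1), b i j * Z (epiMul ((j : ℝ) + 1) u),
    fun i => ⟨?_, ?_, ?_, ?_⟩, ?_⟩
  · exact cont_sum (Finset.range (n + 1)) (b i) (fun j u => Z (epiMul ((j : ℝ) + 1) u))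
      (fun j _ => cont_epiMul hcont (hpos j))
  · exact val_sum (Finset.range (n + 1)) (b i) (fun j u => Z (epiMul ((j : ℝ) + 1) u))
      (fun j _ => val_epiMul hval (hpos j))
  · exact inv_sum (Finset.range (n + 1)) (b i) (fun j u => Z (epiMul ((j : ℝ) + 1) u))
      (fun j _ => inv_epiMul hinv (hpos j))
  · intro u hu l hl
    have key : interpP n Z (epiMul l u) =
        (interpP n Z u).comp (Polynomial.C l * Polynomial.X) := by
      refine Polynomial.eq_of_infinite_eval_eq _ _ ((Set.Ioi_infinite (0 : ℝ)).mono ?_)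
      intro s hs
      have hs' : (0 : ℝ) < s := hs
      show Polynomial.eval s _ = Polynomial.eval s _
      rw [Polynomial.eval_comp, ← interpP_correct hcont hval hinv (epiMul_mem hl hu) hs',
        epiMul_epiMul hs' hl, interpP_correct hcont hval hinv hu (mul_pos hs' hl)]
      rw [Polynomial.eval_mul, Polynomial.eval_C, Polynomial.eval_X, mul_comm]
    have h1 := interpP_coeff Z (epiMul l u) i
    rw [key, Polynomial.comp_C_mul_X_coeff, interpP_coeff] at h1
    rw [Real.rpow_natCast]
    simp only [b]
    rw [← h1, mul_comm]
  · intro u hu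
    have h1 := interpP_correct hcont hval hinv hu one_pos
    have hd : (interpP n Z u).natDegree < n + 1 := by
      have h := Lagrange.degree_interpolate_lt (fun j : ℕ => Z (epiMul ((j : ℝ) + 1) u))
        (node_inj (Finset.range (n + 1)))
      rw [Finset.card_range] at h
      by_cases h0 : interpP n Z u = 0
      · rw [h0]; simp
      · exact (Polynomial.natDegree_lt_iff_degree_lt h0).2 h
    rw [epiMul_one, Polynomial.eval_eq_sum_range' hd] at h1
    rw [h1, Finset.sum_range]
    refine Finset.sum_congr rfl fun i _ => ?_
    rw [one_pow, mul_one, interpP_coeff]
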